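/- For every n ≥ 3, k ≥ 2 and r ≥ 1, the abelianization of the higher dimensional Thompson group nV_{k,r} is isomorphic to (ℤ/(k−1)ℤ)^{n−1} if k is even or k ≡ 3 (mod 4), and is isomorphic to (ℤ/(k−1)ℤ)^{n−1} ⊕ ℤ/2ℤ if k ≡ 1 (mod 4). -/

import Mathlib

namespace NV

/-- The Cantor space `C_k = {0,…,k-1}^ℕ` of one-sided infinite sequences. -/
abbrev Cantor (k : ℕ) : Type := ℕ → Fin k

/-- Concatenation `u·x` of a finite word `u` with an infinite sequence `x`. -/
def concat {k : ℕ} (u : List (Fin k)) (x : Cantor k) : Cantor k :=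
  fun i => if h : i < u.length then u.get ⟨i, h⟩ else x (i - u.length)

/-- The space `Y(n,k,r) = (C_k)^n × {1,…,r}`. -/
abbrev Y (n k r : ℕ) : Type := (Fin n → Cantor k) × Fin r

/-- The box `{(u_1·x_1,…,u_n·x_n, a) : x_1,…,x_n ∈ C_k}` determined by
finite words `u_1,…,u_n` and an index `a`. -/
def box {n k r : ℕ} (u : Fin n → List (Fin k)) (a : Fin r) : Set (Y n k r) :=
  {y | ∃ x : Fin n → Cantor k, y = (fun i => concat (u i) (x i), a)}

/-- A permutation of `Y(n,k,r)` is an element of the higher dimensional Thompson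
group `nV_{k,r}` if there are finitely many tuples of words and indices whose domain
boxes partition `Y(n,k,r)`, whose range boxes partition `Y(n,k,r)`, and on which `γ`
acts by the corresponding prefix substitutions. -/
def IsElement {n k r : ℕ} (γ : Equiv.Perm (Y n k r)) : Prop :=
  ∃ (m : ℕ) (u v : Fin m → Fin n → List (Fin k)) (a b : Fin m → Fin r),
    (∀ y : Y n k r, ∃! t : Fin m, y ∈ box (u t) (a t)) ∧
    (∀ y : Y n k r, ∃! t : Fin m, y ∈ box (v t) (b t)) ∧
    (∀ (t : Fin m) (x : Fin n → Cantor k),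
      γ (fun i => concat (u t i) (x i), a t) = (fun i => concat (v t i) (x i), b t))

/-- The underlying set of the higher dimensional Thompson group `nV_{k,r}`,
as a set of permutations of `Y(n,k,r)`. -/
def thompsonSet (n k r : ℕ) : Set (Equiv.Perm (Y n k r)) := {γ | IsElement γ}

end NV

namespace NV

open Multiset

section Boxes

section Concat

variable {k : ℕ}

theorem concat_append (u w : List (Fin k)) (x : Cantor k) :
    concat (u ++ w) x = concat u (concat w x) := by
  funext i
  unfold concat
  by_cases h : i < u.length
  · have h' : i < (u ++ w).length := by simp; omega
    simp [h, List.getElem_append_left h]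
    omega
  · by_cases h2 : i - u.length < w.length
    · have h' : i < u.length + w.length := by omega
      simp [h, h2, h', List.getElem_append_right (not_lt.1 h)]
    · have h' : ¬ i < u.length + w.length := by omega
      simp [h, h2, h', Nat.sub_sub]

theorem concat_injective (u : List (Fin k)) : Function.Injective (concat u) := by
  intro x y h
  funext i
  simpa [concat] using congrFun h (i + u.length)

/-- The prefix of length `m` of an infinite sequence. -/
def pre (x : Cantor k) (m : ℕ) : List (Fin k) := (List.range m).map x

theorem pre_concat (u : List (Fin k)) (x : Cantor k) : pre (concat u x) u.length = u := by
  apply List.ext_getElem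
  · simp [pre]
  · intro i h1 h2
    simp [pre, concat, h2]

theorem concat_pre (x : Cantor k) (m : ℕ) : concat (pre x m) (fun i => x (i + m)) = x := by
  funext i
  unfold concat
  by_cases h : i < m
  · simp [pre, h]
  · simp [pre, h, Nat.sub_add_cancel (not_lt.1 h)]

theorem pre_succ (x : Cantor k) (m : ℕ) : pre x (m + 1) = pre x m ++ [x m] := by
  simp [pre, List.range_succ]

theorem concat_eq_imp (hk : 2 ≤ k) {u v : List (Fin k)} (h : ∀ x, concat u x = concat v x) :
    u = v := by
  wlog hl : u.length ≤ v.length generalizing u v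
  · exact (this (fun x => (h x).symm) (by omega)).symm
  have x0 : Cantor k := fun _ => ⟨0, by omega⟩
  have huv : v = u ++ v.drop u.length := by
    have h1 := pre_concat u x0
    have h2 := pre_concat v x0
    rw [h x0] at h1
    have : u = v.take u.length := by
      conv_lhs => rw [← h1]
      conv_rhs => rw [← h2]
      simp [pre, ← List.map_take, List.take_range, hl]
    conv_lhs => rw [← List.take_append_drop u.length v, ← this]
  generalize v.drop u.length = w at huv
  subst huv
  cases w with
  | nil => simp
  | cons c w =>
    exfalso
    have : ∃ c' : Fin k, c' ≠ c := by
      have : Nontrivial (Fin k) := Fin.nontrivial_iff_two_le.2 hk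
      exact exists_ne c
    obtain ⟨c', hc'⟩ := this
    have h1 := h (fun _ => c')
    rw [concat_append] at h1
    have h2 := congrFun (concat_injective u h1) 0
    simp [concat] at h2
    exact hc' h2

end Concat

/-- Names of boxes: a tuple of words and an index of a copy of the cube. -/
abbrev Bx (n k r : ℕ) : Type := (Fin n → List (Fin k)) × Fin r

variable {n k r : ℕ}

/-- The canonical parametrization of a box. -/
def emb (B : Bx n k r) (x : Fin n → Cantor k) : Y n k r := (fun i => concat (B.1 i) (x i), B.2)

theorem emb_injective (B : Bx n k r) : Function.Injective (emb B) := by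
  intro x y h
  funext i
  exact concat_injective _ (congrFun (congrArg Prod.fst h) i)

theorem eq_of_emb_eq (hk : 2 ≤ k) {B C : Bx n k r} (h : ∀ x, emb B x = emb C x) : B = C := by
  have x0 : Fin n → Cantor k := fun _ _ => ⟨0, by omega⟩
  refine Prod.ext (funext fun i => concat_eq_imp hk fun x => ?_)
    (congrArg (fun y : Y n k r => y.2) (h x0))
  exact congrFun (congrArg (fun y : Y n k r => y.1) (h fun _ => x)) i

theorem mem_box_iff (B : Bx n k r) (y : Y n k r) :
    y ∈ box B.1 B.2 ↔ y.2 = B.2 ∧ ∀ i, pre (y.1 i) (B.1 i).length = B.1 i := by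
  constructor
  · rintro ⟨x, rfl⟩
    exact ⟨rfl, fun i => pre_concat _ _⟩
  · rintro ⟨h1, h2⟩
    refine ⟨fun i m => y.1 i (m + (B.1 i).length), Prod.ext (funext fun i => ?_) h1⟩
    have := concat_pre (y.1 i) (B.1 i).length
    rw [h2] at this
    exact this.symm

/-- The `j`-th piece of a box cut into `k` pieces in direction `i`. -/
def spl (i : Fin n) (j : Fin k) (B : Bx n k r) : Bx n k r :=
  (Function.update B.1 i (B.1 i ++ [j]), B.2)

theorem spl_comm {i i' : Fin n} (h : i ≠ i') (j j' : Fin k) (B : Bx n k r) :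
    spl i j (spl i' j' B) = spl i' j' (spl i j B) := by
  simp [spl, h, h.symm, Function.update_comm h]

theorem mem_box_spl (i : Fin n) (j : Fin k) (B : Bx n k r) (y : Y n k r) :
    y ∈ box (spl i j B).1 (spl i j B).2 ↔ y ∈ box B.1 B.2 ∧ y.1 i (B.1 i).length = j := by
  rw [mem_box_iff, mem_box_iff, and_assoc]
  refine and_congr Iff.rfl ?_
  constructor
  · intro h
    have hi := h i
    simp only [spl, Function.update_self, List.length_append, List.length_singleton,
      pre_succ] at hi
    have := List.append_inj' hi rfl
    refine ⟨fun l => ?_, by simpa using this.2⟩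
    by_cases hl : l = i
    · subst hl; exact this.1
    · simpa [spl, hl] using h l
  · rintro ⟨h1, h2⟩ l
    by_cases hl : l = i
    · subst hl
      simp [spl, pre_succ, h1, h2]
    · simpa [spl, hl] using h1 l

theorem emb_spl (i : Fin n) (j : Fin k) (B : Bx n k r) (x : Fin n → Cantor k) :
    emb (spl i j B) x = emb B (Function.update x i (concat [j] (x i))) := by
  refine Prod.ext (funext fun l => ?_) rfl
  by_cases hl : l = i
  · subst hl; simp [emb, spl, concat_append]
  · simp [emb, spl, hl]

open Classical in
/-- The indicator function of a box. -/
noncomputable def ind (y : Y n k r) (B : Bx n k r) : ℕ := if y ∈ box B.1 B.2 then 1 else 0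

theorem sum_ind_spl (y : Y n k r) (i : Fin n) (B : Bx n k r) :
    ∑ j : Fin k, ind y (spl i j B) = ind y B := by
  classical
  by_cases h : y ∈ box B.1 B.2 <;> simp [ind, mem_box_spl, h]

/-- A finite family of boxes that partitions the space. -/
def IsPart (P : Multiset (Bx n k r)) : Prop := ∀ y, (P.map (ind y)).sum = 1

/-- A pair of partitions into boxes, with a matching between them. -/
def IsTab (M : Multiset (Bx n k r × Bx n k r)) : Prop :=
  IsPart (M.map Prod.fst) ∧ IsPart (M.map Prod.snd)

theorem IsPart.exists_mem {P : Multiset (Bx n k r)} (h : IsPart P) (y : Y n k r) :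
    ∃ B ∈ P, y ∈ box B.1 B.2 := by
  by_contra! hc
  have : (P.map (ind y)).sum = 0 := by
    rw [Multiset.sum_eq_zero_iff]
    simp only [Multiset.mem_map]
    rintro _ ⟨B, hB, rfl⟩
    simp [ind, hc B hB]
  have := h y
  omega

theorem IsPart.disjoint {B C : Bx n k r} {R : Multiset (Bx n k r)} (h : IsPart (B ::ₘ C ::ₘ R))
    (y : Y n k r) (hB : y ∈ box B.1 B.2) : y ∉ box C.1 C.2 := by
  intro hC
  have := h y
  simp [ind, hB, hC] at this

theorem box_nonempty (hk : 2 ≤ k) (B : Bx n k r) : ∃ y, y ∈ box B.1 B.2 :=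
  ⟨emb B fun _ _ => ⟨0, by omega⟩, _, rfl⟩

theorem IsPart.nodup (hk : 2 ≤ k) {P : Multiset (Bx n k r)} (h : IsPart P) : P.Nodup := by
  rw [Multiset.nodup_iff_ne_cons_cons]
  rintro B R rfl
  obtain ⟨y, hy⟩ := box_nonempty hk B
  exact h.disjoint y hy hy

theorem IsTab.nodup (hk : 2 ≤ k) {M : Multiset (Bx n k r × Bx n k r)} (h : IsTab M) : M.Nodup :=
  Multiset.Nodup.of_map _ (h.1.nodup hk)

end Boxes

section Matchings

section Split

variable {α β : Type*} {n k : ℕ}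

/-- All pieces of `a` when cut in direction `i`, for a cutting operation `sp`. -/
def pieces (sp : Fin n → Fin k → α → α) (i : Fin n) (a : α) : Multiset α :=
  (Finset.univ : Finset (Fin k)).val.map fun j => sp i j a

/-- `Refines sp M M'` says that `M'` arises from `M` by successively cutting elements. -/
inductive Refines (sp : Fin n → Fin k → α → α) : Multiset α → Multiset α → Prop
  | refl (M) : Refines sp M M
  | split {M : Multiset α} {a : α} {R : Multiset α} (i : Fin n) :
      Refines sp M (a ::ₘ R) → Refines sp M (pieces sp i a + R)

variable {sp : Fin n → Fin k → α → α}

theorem card_pieces (i : Fin n) (a : α) : card (pieces sp i a) = k := by simp [pieces]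

theorem Refines.trans {M M' M'' : Multiset α} (h : Refines sp M M') (h' : Refines sp M' M'') :
    Refines sp M M'' := by
  induction h' with
  | refl => exact h
  | split i _ ih => exact ih.split i

theorem Refines.add_right {M M' : Multiset α} (h : Refines sp M M') (K : Multiset α) :
    Refines sp (M + K) (M' + K) := by
  induction h with
  | refl => exact .refl _
  | split i _ ih =>
    rw [cons_add] at ih
    rw [add_assoc]
    exact ih.split i

theorem Refines.add_left {M M' : Multiset α} (h : Refines sp M M') (K : Multiset α) :
    Refines sp (K + M) (K + M') := by
  rw [add_comm K, add_comm K]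
  exact h.add_right K

theorem refines_pieces (i : Fin n) (a : α) : Refines sp {a} (pieces sp i a) := by
  simpa using Refines.split (R := 0) i (Refines.refl {a})

theorem Refines.card_modEq {M M' : Multiset α} (h : Refines sp M M') (hk : 1 ≤ k) :
    ∃ e, card M' = card M + e * (k - 1) := by
  induction h with
  | refl => exact ⟨0, by simp⟩
  | split i _ ih =>
    obtain ⟨e, he⟩ := ih
    refine ⟨e + 1, ?_⟩
    simp only [card_cons] at he
    simp only [card_add, card_pieces, add_mul]
    omega

theorem map_pieces {sp' : Fin n → Fin k → β → β} (f : α → β)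
    (hf : ∀ i j a, f (sp i j a) = sp' i j (f a)) (i : Fin n) (a : α) :
    (pieces sp i a).map f = pieces sp' i (f a) := by
  simp only [pieces, Multiset.map_map, Function.comp_def, hf]

theorem Refines.map {sp' : Fin n → Fin k → β → β} (f : α → β)
    (hf : ∀ i j a, f (sp i j a) = sp' i j (f a)) {M M' : Multiset α} (h : Refines sp M M') :
    Refines sp' (M.map f) (M'.map f) := by
  induction h with
  | refl => exact .refl _
  | split i _ ih =>
    rw [map_cons] at ih
    rw [Multiset.map_add, map_pieces f hf]
    exact ih.split i

theorem exists_refines_of_forall {U : α → Prop} (M : Multiset α)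
    (h : ∀ a ∈ M, ∃ M', Refines sp {a} M' ∧ ∀ b ∈ M', U b) :
    ∃ M', Refines sp M M' ∧ ∀ b ∈ M', U b := by
  induction M using Multiset.induction with
  | empty => exact ⟨0, .refl _, by simp⟩
  | cons a M ih =>
    obtain ⟨A, hA, hA'⟩ := h a (mem_cons_self a M)
    obtain ⟨B, hB, hB'⟩ := ih fun b hb => h b (mem_cons_of_mem hb)
    refine ⟨A + B, ?_, ?_⟩
    · rw [← singleton_add]
      exact (hA.add_right M).trans (hB.add_left A)
    · intro b hb
      rcases mem_add.1 hb with hb | hb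
      · exact hA' b hb
      · exact hB' b hb

theorem exists_refines_uniform (ln : α → Fin n → ℕ)
    (hln : ∀ i j a, ln (sp i j a) = Function.update (ln a) i (ln a i + 1)) (N : ℕ)
    (M : Multiset α) (hM : ∀ a ∈ M, ∀ i, ln a i ≤ N) :
    ∃ M', Refines sp M M' ∧ ∀ b ∈ M', ∀ i, ln b i = N := by
  have key : ∀ s, ∀ a, (∀ i, ln a i ≤ N) → ∑ i, (N - ln a i) = s →
      ∃ M', Refines sp {a} M' ∧ ∀ b ∈ M', ∀ i, ln b i = N := by
    intro s
    induction s with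
    | zero =>
      intro a ha hs
      refine ⟨{a}, .refl _, ?_⟩
      simp only [mem_singleton, forall_eq]
      intro i
      have := (Finset.sum_eq_zero_iff.1 hs) i (Finset.mem_univ _)
      have := ha i
      omega
    | succ s ih =>
      intro a ha hs
      have : ∃ i, ln a i < N := by
        by_contra! hc
        have : ∑ i, (N - ln a i) = 0 :=
          Finset.sum_eq_zero fun i _ => Nat.sub_eq_zero_of_le (hc i)
        omega
      obtain ⟨i, hi⟩ := this
      obtain ⟨M', h1, h2⟩ := exists_refines_of_forall (sp := sp)
        (U := fun b => ∀ i, ln b i = N) (pieces sp i a) (by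
          intro b hb
          obtain ⟨j, -, rfl⟩ := Multiset.mem_map.1 hb
          apply ih
          · intro l
            rw [hln]
            by_cases hl : l = i
            · subst hl; simpa using hi
            · simpa [hl] using ha l
          · rw [← Finset.add_sum_erase _ _ (Finset.mem_univ i)] at hs ⊢
            have : ∀ l ∈ Finset.univ.erase i, N - ln (sp i j a) l = N - ln a l := by
              intro l hl
              rw [hln, Function.update_of_ne (Finset.ne_of_mem_erase hl)]
            rw [Finset.sum_congr rfl this, hln, Function.update_self]
            omega)
      exact ⟨M', (refines_pieces i a).trans h1, h2⟩
  exact exists_refines_of_forall M fun a ha => key _ a (hM a ha) rfl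

theorem exists_bound (ln : α → Fin n → ℕ) (M : Multiset α) :
    ∃ N, ∀ N' ≥ N, ∀ a ∈ M, ∀ i, ln a i ≤ N' := by
  induction M using Multiset.induction with
  | empty => exact ⟨0, by simp⟩
  | cons a M ih =>
    obtain ⟨N, hN⟩ := ih
    refine ⟨N + ∑ i, ln a i, fun N' hN' b hb i => ?_⟩
    rcases mem_cons.1 hb with rfl | hb
    · have := Finset.single_le_sum (f := ln b) (fun _ _ => Nat.zero_le _) (Finset.mem_univ i)
      omega
    · exact hN N' (by omega) b hb i

end Split

variable {n k r : ℕ}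

/-- Cutting both boxes of a pair. -/
def spl₂ (i : Fin n) (j : Fin k) (p : Bx n k r × Bx n k r) : Bx n k r × Bx n k r :=
  (spl i j p.1, spl i j p.2)

/-- The lengths of the words of a box. -/
def len (B : Bx n k r) (i : Fin n) : ℕ := (B.1 i).length

theorem len_spl (i : Fin n) (j : Fin k) (B : Bx n k r) :
    len (spl i j B) = Function.update (len B) i (len B i + 1) := by
  funext l
  by_cases hl : l = i
  · subst hl; simp [len, spl]
  · simp [len, spl, hl]

theorem IsPart.of_sum_eq {P P' : Multiset (Bx n k r)} (h : IsPart P)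
    (h' : ∀ y, (P'.map (ind y)).sum = (P.map (ind y)).sum) : IsPart P' :=
  fun y => (h' y).trans (h y)

theorem sum_ind_pieces (y : Y n k r) (i : Fin n) (B : Bx n k r) :
    ((pieces spl i B).map (ind y)).sum = ind y B := by
  rw [← sum_ind_spl y i B]
  simp only [pieces, Multiset.map_map, Function.comp_def, Finset.sum]

theorem Refines.sum_ind {P P' : Multiset (Bx n k r)} (h : Refines spl P P') (y : Y n k r) :
    (P'.map (ind y)).sum = (P.map (ind y)).sum := by
  induction h with
  | refl => rfl
  | split i _ ih =>
    rw [← ih]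
    simp [sum_ind_pieces]

theorem IsPart.refines {P P' : Multiset (Bx n k r)} (h : IsPart P) (h' : Refines spl P P') :
    IsPart P' :=
  h.of_sum_eq h'.sum_ind

theorem IsTab.refines {M M' : Multiset (Bx n k r × Bx n k r)} (h : IsTab M)
    (h' : Refines spl₂ M M') : IsTab M' :=
  ⟨h.1.refines (h'.map Prod.fst fun _ _ _ => rfl), h.2.refines (h'.map Prod.snd fun _ _ _ => rfl)⟩

theorem eq_of_len_eq {B C : Bx n k r} {y : Y n k r} (h : len B = len C) (hB : y ∈ box B.1 B.2)
    (hC : y ∈ box C.1 C.2) : B = C := by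
  rw [mem_box_iff] at hB hC
  refine Prod.ext (funext fun i => ?_) (hB.1.symm.trans hC.1)
  rw [← hB.2 i, ← hC.2 i]
  exact congrArg _ (congrFun h i)

theorem IsPart.subset_of_len_eq (hk : 2 ≤ k) {P Q : Multiset (Bx n k r)} (hQ : IsPart Q)
    {N : ℕ} (hP' : ∀ B ∈ P, ∀ i, len B i = N) (hQ' : ∀ B ∈ Q, ∀ i, len B i = N) {B : Bx n k r}
    (hB : B ∈ P) : B ∈ Q := by
  obtain ⟨y, hy⟩ := box_nonempty hk B
  obtain ⟨C, hC, hyC⟩ := hQ.exists_mem y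
  rwa [eq_of_len_eq (funext fun i => (hP' B hB i).trans (hQ' C hC i).symm) hy hyC]

theorem IsPart.eq_of_len_eq (hk : 2 ≤ k) {P Q : Multiset (Bx n k r)} (hP : IsPart P)
    (hQ : IsPart Q) {N : ℕ} (hP' : ∀ B ∈ P, ∀ i, len B i = N) (hQ' : ∀ B ∈ Q, ∀ i, len B i = N) :
    P = Q :=
  (Multiset.Nodup.ext (hP.nodup hk) (hQ.nodup hk)).2 fun _ =>
    ⟨hQ.subset_of_len_eq hk hP' hQ', hP.subset_of_len_eq hk hQ' hP'⟩

/-- Any two partitions have a common refinement. -/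
theorem IsPart.exists_common (hk : 2 ≤ k) {P Q : Multiset (Bx n k r)} (hP : IsPart P)
    (hQ : IsPart Q) : ∃ S, Refines spl P S ∧ Refines spl Q S := by
  obtain ⟨N, hN⟩ := exists_bound len (P + Q)
  obtain ⟨S, h1, h2⟩ := exists_refines_uniform len len_spl N P fun a ha =>
    hN N le_rfl a (mem_add.2 (Or.inl ha))
  obtain ⟨S', h1', h2'⟩ := exists_refines_uniform len len_spl N Q fun a ha =>
    hN N le_rfl a (mem_add.2 (Or.inr ha))
  refine ⟨S, h1, ?_⟩
  rwa [(hP.refines h1).eq_of_len_eq hk (hQ.refines h1') h2 h2']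

theorem IsPart.card_eq (hk : 2 ≤ k) {P Q : Multiset (Bx n k r)} (hP : IsPart P) (hQ : IsPart Q) :
    ∃ e e', card P + e * (k - 1) = card Q + e' * (k - 1) := by
  obtain ⟨S, h, h'⟩ := hP.exists_common hk hQ
  obtain ⟨e, he⟩ := h.card_modEq (by omega)
  obtain ⟨e', he'⟩ := h'.card_modEq (by omega)
  exact ⟨e, e', he.symm.trans he'⟩

end Matchings

section Tables

variable {n k r : ℕ}

/-- `γ` maps the box `p.1` to the box `p.2` by prefix substitution. -/
def Acts (γ : Equiv.Perm (Y n k r)) (p : Bx n k r × Bx n k r) : Prop :=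
  ∀ x, γ (emb p.1 x) = emb p.2 x

/-- `M` is a table describing `γ`. -/
def IsTable (γ : Equiv.Perm (Y n k r)) (M : Multiset (Bx n k r × Bx n k r)) : Prop :=
  IsTab M ∧ ∀ p ∈ M, Acts γ p

theorem Acts.spl₂ {γ : Equiv.Perm (Y n k r)} {p : Bx n k r × Bx n k r} (h : Acts γ p) (i : Fin n)
    (j : Fin k) : Acts γ (spl₂ i j p) := by
  intro x
  simp only [NV.spl₂, emb_spl]
  exact h _

theorem IsTable.refines {γ : Equiv.Perm (Y n k r)} {M M' : Multiset (Bx n k r × Bx n k r)}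
    (h : IsTable γ M) (h' : Refines spl₂ M M') : IsTable γ M' := by
  refine ⟨h.1.refines h', ?_⟩
  have := h.2
  clear h
  induction h' with
  | refl => exact this
  | @split a R i _ ih =>
    intro p hp
    rcases mem_add.1 hp with hp | hp
    · obtain ⟨j, -, rfl⟩ := Multiset.mem_map.1 hp
      exact (ih a (mem_cons_self _ _)).spl₂ i j
    · exact ih p (mem_cons_of_mem hp)

theorem Acts.mem {γ : Equiv.Perm (Y n k r)} {p : Bx n k r × Bx n k r} (h : Acts γ p) {y : Y n k r}
    (hy : y ∈ box p.1.1 p.1.2) : γ y ∈ box p.2.1 p.2.2 := by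
  obtain ⟨x, rfl⟩ := hy
  exact ⟨x, h x⟩

theorem IsTable.unique {γ γ' : Equiv.Perm (Y n k r)} {M : Multiset (Bx n k r × Bx n k r)}
    (h : IsTable γ M) (h' : IsTable γ' M) : γ = γ' := by
  ext1 y
  obtain ⟨B, hB, x, rfl⟩ := h.1.1.exists_mem y
  obtain ⟨p, hp, rfl⟩ := Multiset.mem_map.1 hB
  exact (h.2 p hp x).trans (h'.2 p hp x).symm

theorem IsTab.exists_fun {M : Multiset (Bx n k r × Bx n k r)} (h : IsTab M) :
    ∃ f : Y n k r → Y n k r, ∀ p ∈ M, ∀ x, f (emb p.1 x) = emb p.2 x := by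
  have : ∀ y, ∃ p ∈ M, ∃ x, y = emb p.1 x := by
    intro y
    obtain ⟨B, hB, x, hx⟩ := h.1.exists_mem y
    obtain ⟨p, hp, rfl⟩ := Multiset.mem_map.1 hB
    exact ⟨p, hp, x, hx⟩
  choose q hq x hx using this
  refine ⟨fun y => emb (q y).2 (x y), fun p hp z => ?_⟩
  have hqp : q (emb p.1 z) = p := by
    by_contra hne
    obtain ⟨M, rfl⟩ := Multiset.exists_cons_of_mem hp
    have : q (emb p.1 z) ∈ M := by simpa [hne] using hq (emb p.1 z)
    obtain ⟨M, rfl⟩ := Multiset.exists_cons_of_mem this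
    have h1 := h.1
    simp only [map_cons] at h1
    exact h1.disjoint (emb p.1 z) ⟨_, rfl⟩ ⟨_, hx _⟩
  have := hx (emb p.1 z)
  rw [hqp] at this
  dsimp only
  rw [hqp, ← emb_injective _ this]

/-- Every pair of partitions with a matching describes a homeomorphism. -/
theorem IsTab.exists_isTable {M : Multiset (Bx n k r × Bx n k r)} (h : IsTab M) :
    ∃ γ, IsTable γ M := by
  have h' : IsTab (M.map Prod.swap) := by
    constructor
    · simpa using h.2
    · simpa using h.1
  obtain ⟨f, hf⟩ := h.exists_fun
  obtain ⟨g, hg⟩ := h'.exists_fun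
  refine ⟨⟨f, g, fun y => ?_, fun y => ?_⟩, h, hf⟩
  · obtain ⟨B, hB, x, rfl⟩ := h.1.exists_mem y
    obtain ⟨p, hp, rfl⟩ := Multiset.mem_map.1 hB
    exact (congrArg g (hf p hp x)).trans (hg p.swap (Multiset.mem_map_of_mem _ hp) x)
  · obtain ⟨B, hB, x, rfl⟩ := h.2.exists_mem y
    obtain ⟨p, hp, rfl⟩ := Multiset.mem_map.1 hB
    exact (congrArg f (hg p.swap (Multiset.mem_map_of_mem _ hp) x)).trans (hf p hp x)

theorem isPart_map_iff {ι : Type*} [Fintype ι] (f : ι → Bx n k r) :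
    IsPart (Finset.univ.val.map f) ↔ ∀ y, ∃! t, y ∈ box (f t).1 (f t).2 := by
  classical
  refine forall_congr' fun y => ?_
  rw [Multiset.map_map]
  change ∑ t, ind y (f t) = 1 ↔ _
  simp only [ind, Finset.sum_boole, Nat.cast_id]
  rw [Finset.card_eq_one]
  constructor
  · rintro ⟨a, ha⟩
    refine ⟨a, ?_, fun b hb => ?_⟩
    · have : a ∈ Finset.univ.filter fun t => y ∈ box (f t).1 (f t).2 := by simp [ha]
      simpa using this
    · have : b ∈ Finset.univ.filter fun t => y ∈ box (f t).1 (f t).2 := by simpa using hb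
      simpa [ha] using this
  · rintro ⟨a, ha, ha'⟩
    refine ⟨a, Finset.ext fun b => ?_⟩
    simp only [Finset.mem_filter, Finset.mem_univ, true_and, Finset.mem_singleton]
    exact ⟨ha' b, fun h => h ▸ ha⟩

theorem isElement_iff (γ : Equiv.Perm (Y n k r)) : IsElement γ ↔ ∃ M, IsTable γ M := by
  constructor
  · rintro ⟨m, u, v, a, b, h1, h2, h3⟩
    refine ⟨Finset.univ.val.map fun t : Fin m => ((u t, a t), (v t, b t)), ⟨?_, ?_⟩, ?_⟩
    · rw [Multiset.map_map]
      exact (isPart_map_iff _).2 h1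
    · rw [Multiset.map_map]
      exact (isPart_map_iff _).2 h2
    · intro p hp x
      obtain ⟨t, -, rfl⟩ := Multiset.mem_map.1 hp
      exact h3 t x
  · rintro ⟨M, ⟨h1, h2⟩, h3⟩
    induction M using Quotient.inductionOn with
    | h L =>
      have hL : (↑L : Multiset _) = (Finset.univ : Finset (Fin L.length)).val.map L.get := by
        rw [Fin.univ_val_map, List.ofFn_get]
      rw [quot_mk_to_coe, hL] at h1 h2
      rw [Multiset.map_map] at h1 h2
      refine ⟨L.length, fun t => (L.get t).1.1, fun t => (L.get t).2.1, fun t => (L.get t).1.2,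
        fun t => (L.get t).2.2, (isPart_map_iff _).1 h1, (isPart_map_iff _).1 h2, fun t x => ?_⟩
      exact h3 (L.get t) (by simp) x

/-- An additive invariant of matched pairs of partitions. -/
structure Inv {A : Type*} [AddCommGroup A] (val : Multiset (Bx n k r × Bx n k r) → A) :
    Prop where
  split : ∀ {p : Bx n k r × Bx n k r} {R : Multiset (Bx n k r × Bx n k r)} (i : Fin n),
    IsTab (p ::ₘ R) → val (pieces spl₂ i p + R) = val (p ::ₘ R)
  comp : ∀ (T : Multiset (Bx n k r × Bx n k r × Bx n k r)),
    IsPart (T.map fun t => t.1) → IsPart (T.map fun t => t.2.1) → IsPart (T.map fun t => t.2.2) →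
    val (T.map fun t => (t.1, t.2.2)) =
      val (T.map fun t => (t.1, t.2.1)) + val (T.map fun t => (t.2.1, t.2.2))

variable {A : Type*} [AddCommGroup A] {val : Multiset (Bx n k r × Bx n k r) → A}

theorem Inv.refines (hv : Inv val) {M M' : Multiset (Bx n k r × Bx n k r)} (h : IsTab M)
    (h' : Refines spl₂ M M') : val M' = val M := by
  induction h' with
  | refl => rfl
  | split i h' ih =>
    rw [hv.split i (h.refines h'), ih]

theorem IsTable.mem_of_len_eq (hk : 2 ≤ k) {γ : Equiv.Perm (Y n k r)}
    {M M' : Multiset (Bx n k r × Bx n k r)} (h : IsTable γ M) (h' : IsTable γ M') {N : ℕ}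
    (hM : ∀ p ∈ M, ∀ i, len p.1 i = N) (hM' : ∀ p ∈ M', ∀ i, len p.1 i = N)
    {p : Bx n k r × Bx n k r} (hp : p ∈ M) : p ∈ M' := by
  have : p.1 ∈ M'.map Prod.fst := by
    refine IsPart.subset_of_len_eq hk (P := M.map Prod.fst) h'.1.1 (N := N) ?_ ?_
      (mem_map_of_mem _ hp)
    · intro B hB
      obtain ⟨q, hq, rfl⟩ := Multiset.mem_map.1 hB
      exact hM q hq
    · intro B hB
      obtain ⟨q, hq, rfl⟩ := Multiset.mem_map.1 hB
      exact hM' q hq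
  obtain ⟨q, hq, hqp⟩ := Multiset.mem_map.1 this
  have h2 : p.2 = q.2 := eq_of_emb_eq hk fun x => by
    rw [← h.2 p hp x, ← h'.2 q hq x, hqp]
  rwa [Prod.ext hqp.symm h2]

theorem IsTable.exists_common (hk : 2 ≤ k) {γ : Equiv.Perm (Y n k r)}
    {M M' : Multiset (Bx n k r × Bx n k r)} (h : IsTable γ M) (h' : IsTable γ M') :
    ∃ S, Refines spl₂ M S ∧ Refines spl₂ M' S := by
  have hl : ∀ i j (p : Bx n k r × Bx n k r), len (spl₂ i j p).1 =
    Function.update (len p.1) i (len p.1 i + 1) := fun i j p => len_spl i j p.1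
  obtain ⟨N, hN⟩ := exists_bound (fun p : Bx n k r × Bx n k r => len p.1) (M + M')
  obtain ⟨S, h1, h2⟩ := exists_refines_uniform (fun p : Bx n k r × Bx n k r => len p.1) hl N M
    fun a ha => hN N le_rfl a (mem_add.2 (Or.inl ha))
  obtain ⟨S', h1', h2'⟩ := exists_refines_uniform (fun p : Bx n k r × Bx n k r => len p.1) hl N M'
    fun a ha => hN N le_rfl a (mem_add.2 (Or.inr ha))
  refine ⟨S, h1, ?_⟩
  have hS := h.refines h1
  have hS' := h'.refines h1'
  rwa [(Multiset.Nodup.ext (hS.1.nodup hk) (hS'.1.nodup hk)).2 fun p =>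
    ⟨hS.mem_of_len_eq hk hS' h2 h2', hS'.mem_of_len_eq hk hS h2' h2⟩]

theorem Inv.eq_of_isTable (hk : 2 ≤ k) (hv : Inv val) {γ : Equiv.Perm (Y n k r)}
    {M M' : Multiset (Bx n k r × Bx n k r)} (h : IsTable γ M) (h' : IsTable γ M') :
    val M = val M' := by
  obtain ⟨S, h1, h2⟩ := h.exists_common hk h'
  rw [← hv.refines h.1 h1, hv.refines h'.1 h2]

/-- Tables of composable elements can be refined so that they match. -/
theorem exists_triples (hk : 2 ≤ k) {γ γ' : Equiv.Perm (Y n k r)}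
    {M M' : Multiset (Bx n k r × Bx n k r)} (h : IsTable γ M) (h' : IsTable γ' M') :
    ∃ T : Multiset (Bx n k r × Bx n k r × Bx n k r),
      IsTable γ (T.map fun t => (t.1, t.2.1)) ∧ IsTable γ' (T.map fun t => (t.2.1, t.2.2)) ∧
      IsTable (γ' * γ) (T.map fun t => (t.1, t.2.2)) := by
  obtain ⟨N, hN⟩ := exists_bound (fun p : Bx n k r × Bx n k r => len p.2) M
  obtain ⟨N', hN'⟩ := exists_bound (fun p : Bx n k r × Bx n k r => len p.1) M'
  obtain ⟨S, h1, h2⟩ := exists_refines_uniform (fun p : Bx n k r × Bx n k r => len p.2)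
    (sp := spl₂) (fun i j p => len_spl i j p.2) (max N N') M (hN _ (le_max_left _ _))
  obtain ⟨S', h1', h2'⟩ := exists_refines_uniform (fun p : Bx n k r × Bx n k r => len p.1)
    (sp := spl₂) (fun i j p => len_spl i j p.1) (max N N') M' (hN' _ (le_max_right _ _))
  replace h := h.refines h1
  replace h' := h'.refines h1'
  have hSS' : S.map Prod.snd = S'.map Prod.fst := by
    refine h.1.2.eq_of_len_eq hk h'.1.1 (N := max N N') ?_ ?_
    · intro B hB
      obtain ⟨q, hq, rfl⟩ := Multiset.mem_map.1 hB
      exact h2 q hq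
    · intro B hB
      obtain ⟨q, hq, rfl⟩ := Multiset.mem_map.1 hB
      exact h2' q hq
  have hg : ∀ C, ∃ D, C ∈ S'.map Prod.fst → (C, D) ∈ S' := by
    intro C
    by_cases hC : C ∈ S'.map Prod.fst
    · obtain ⟨q, hq, rfl⟩ := Multiset.mem_map.1 hC
      exact ⟨q.2, fun _ => hq⟩
    · exact ⟨C, fun h => absurd h hC⟩
  choose g hg using hg
  have hg' : ∀ p ∈ S', (p.1, g p.1) = p := by
    intro p hp
    refine Prod.ext rfl (eq_of_emb_eq hk fun x => ?_)
    rw [← h'.2 p hp x, ← h'.2 _ (hg p.1 (mem_map_of_mem _ hp)) x]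
  have e1 : S'.map (fun p => (p.1, g p.1)) = S' := by
    conv_rhs => rw [← Multiset.map_id S']
    exact Multiset.map_congr rfl hg'
  have e2 : S.map (fun p => (p.2, g p.2)) = S' := by
    have := congrArg (Multiset.map fun C => (C, g C)) hSS'
    rw [Multiset.map_map, Multiset.map_map] at this
    exact this.trans e1
  refine ⟨S.map fun p => (p.1, p.2, g p.2), ?_, ?_, ⟨?_, ?_⟩, ?_⟩
  · simpa using h
  · rw [Multiset.map_map]
    change IsTable γ' (S.map fun p => (p.2, g p.2))
    rwa [e2]
  · simpa [Multiset.map_map, Function.comp_def] using h.1.1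
  · have := h'.1.2
    rw [← e2] at this
    simpa [Multiset.map_map, Function.comp_def] using this
  · intro q hq x
    simp only [Multiset.map_map, Multiset.mem_map, Function.comp_apply] at hq
    obtain ⟨p, hp, rfl⟩ := hq
    rw [Equiv.Perm.mul_apply]
    dsimp only
    rw [h.2 p hp x]
    refine h'.2 (p.2, g p.2) ?_ x
    apply hg
    rw [← hSS']
    exact mem_map_of_mem _ hp

/-- Additive invariants define homomorphisms. -/
theorem Inv.exists_hom (hk : 2 ≤ k) (hv : Inv val) (G : Subgroup (Equiv.Perm (Y n k r)))
    (hG : (G : Set (Equiv.Perm (Y n k r))) = thompsonSet n k r) :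
    ∃ Φ : G →* Multiplicative A, ∀ (γ : G) (M), IsTable γ.1 M →
      Φ γ = Multiplicative.ofAdd (val M) := by
  have hex : ∀ γ : G, ∃ M, IsTable γ.1 M := fun γ => by
    rw [← isElement_iff]
    have := γ.2
    rwa [← SetLike.mem_coe, hG] at this
  choose tb htb using hex
  refine ⟨MonoidHom.mk' (fun γ => Multiplicative.ofAdd (val (tb γ))) fun γ γ' => ?_,
    fun γ M hM => congrArg Multiplicative.ofAdd (hv.eq_of_isTable hk (htb γ) hM)⟩
  obtain ⟨T, h1, h2, h3⟩ := exists_triples hk (htb γ') (htb γ)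
  rw [← ofAdd_add, hv.eq_of_isTable hk (htb γ') h1, hv.eq_of_isTable hk (htb γ) h2,
    hv.eq_of_isTable hk (htb (γ * γ')) h3, hv.comp T, add_comm]
  · simpa [Multiset.map_map, Function.comp_def] using h1.1.1
  · simpa [Multiset.map_map, Function.comp_def] using h1.1.2
  · simpa [Multiset.map_map, Function.comp_def] using h2.1.2

/-- Homomorphisms to abelian groups define additive invariants. -/
theorem exists_inv (G : Subgroup (Equiv.Perm (Y n k r)))
    (hG : (G : Set (Equiv.Perm (Y n k r))) = thompsonSet n k r) (f : G →* Multiplicative A) :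
    ∃ val : Multiset (Bx n k r × Bx n k r) → A, Inv val ∧
      ∀ (γ : G) (M), IsTable γ.1 M → val M = (f γ).toAdd := by
  classical
  have hex : ∀ M : Multiset (Bx n k r × Bx n k r), ∃ γ : G, IsTab M → IsTable γ.1 M := by
    intro M
    by_cases hM : IsTab M
    · obtain ⟨γ, hγ⟩ := hM.exists_isTable
      refine ⟨⟨γ, ?_⟩, fun _ => hγ⟩
      rw [← SetLike.mem_coe, hG]
      exact (isElement_iff γ).2 ⟨M, hγ⟩
    · exact ⟨1, fun h => absurd h hM⟩
  choose el hel using hex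
  refine ⟨fun M => (f (el M)).toAdd, ⟨fun {p R} i h => ?_, fun T h1 h2 h3 => ?_⟩, fun γ M hM => ?_⟩
  · have hr : Refines spl₂ (p ::ₘ R) (pieces spl₂ i p + R) := (Refines.refl _).split i
    have := (hel _ (h.refines hr)).unique ((hel _ h).refines hr)
    rw [Subtype.ext this]
  · have e12 := hel (T.map fun t => (t.1, t.2.1)) ⟨by simpa using h1, by simpa using h2⟩
    have e23 := hel (T.map fun t => (t.2.1, t.2.2)) ⟨by simpa using h2, by simpa using h3⟩
    have e13 := hel (T.map fun t => (t.1, t.2.2)) ⟨by simpa using h1, by simpa using h3⟩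
    have : IsTable (el (T.map fun t => (t.2.1, t.2.2)) * el (T.map fun t => (t.1, t.2.1))).1
        (T.map fun t => (t.1, t.2.2)) := by
      refine ⟨e13.1, fun p hp x => ?_⟩
      obtain ⟨t, ht, rfl⟩ := Multiset.mem_map.1 hp
      exact (congrArg _ (e12.2 _ (mem_map_of_mem _ ht) x)).trans
        (e23.2 _ (mem_map_of_mem _ ht) x)
    rw [Subtype.ext (e13.unique this), map_mul, toAdd_mul, add_comm]
  · exact congrArg (fun γ => (f γ).toAdd) (Subtype.ext ((hel M hM.1).unique hM))

end Tables

section Elementary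

variable {n k r : ℕ}

/-- The identity matching. -/
def diag (R : Multiset (Bx n k r)) : Multiset (Bx n k r × Bx n k r) := R.map fun B => (B, B)

/-- The table exchanging two boxes. -/
def swapTab (B C : Bx n k r) (R : Multiset (Bx n k r)) : Multiset (Bx n k r × Bx n k r) :=
  {(B, C), (C, B)} + diag R

/-- The matching of the pieces of a box in direction `i` with those in direction `i'`. -/
def turn (i i' : Fin n) (B : Bx n k r) : Multiset (Bx n k r × Bx n k r) :=
  (Finset.univ : Finset (Fin k)).val.map fun j => (spl i j B, spl i' j B)

theorem map_fst_diag (R : Multiset (Bx n k r)) : (diag R).map Prod.fst = R := by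
  simp [diag, Multiset.map_map]

theorem map_snd_diag (R : Multiset (Bx n k r)) : (diag R).map Prod.snd = R := by
  simp [diag, Multiset.map_map]

theorem diag_add (R R' : Multiset (Bx n k r)) : diag (R + R') = diag R + diag R' :=
  Multiset.map_add _ _ _

theorem diag_cons (B : Bx n k r) (R : Multiset (Bx n k r)) :
    diag (B ::ₘ R) = (B, B) ::ₘ diag R :=
  Multiset.map_cons _ _ _

theorem map_fst_turn (i i' : Fin n) (B : Bx n k r) :
    (turn i i' B).map Prod.fst = pieces spl i B := by
  simp only [turn, pieces, Multiset.map_map, Function.comp_def]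

theorem map_snd_turn (i i' : Fin n) (B : Bx n k r) :
    (turn i i' B).map Prod.snd = pieces spl i' B := by
  simp only [turn, pieces, Multiset.map_map, Function.comp_def]

theorem IsPart.pieces_add {B : Bx n k r} {R : Multiset (Bx n k r)} (h : IsPart (B ::ₘ R))
    (i : Fin n) : IsPart (pieces spl i B + R) :=
  h.refines ((Refines.refl _).split i)

theorem IsPart.swapTab {B C : Bx n k r} {R : Multiset (Bx n k r)} (h : IsPart ({B, C} + R)) :
    IsTab (swapTab B C R) := by
  constructor
  · simpa [NV.swapTab, map_fst_diag] using h
  · simpa [NV.swapTab, map_snd_diag, Multiset.cons_swap C B] using h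

theorem IsPart.turn {B : Bx n k r} {R : Multiset (Bx n k r)} (h : IsPart (B ::ₘ R))
    (i i' : Fin n) : IsTab (turn i i' B + diag R) := by
  constructor
  · simpa only [Multiset.map_add, map_fst_turn, map_fst_diag] using h.pieces_add i
  · simpa only [Multiset.map_add, map_snd_turn, map_snd_diag] using h.pieces_add i'

theorem exists_matching {P Q : Multiset (Bx n k r)} (h : card P = card Q) :
    ∃ Z : Multiset (Bx n k r × Bx n k r), Z.map Prod.fst = P ∧ Z.map Prod.snd = Q := by
  induction P, Q using Quotient.inductionOn₂ with
  | h l l' =>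
    simp only [quot_mk_to_coe, coe_card] at h
    refine ⟨↑(l.zip l'), ?_, ?_⟩
    · simp [List.map_fst_zip, h]
    · simp [List.map_snd_zip, h]

theorem exists_comp {M M' : Multiset (Bx n k r × Bx n k r)}
    (h : M.map Prod.snd = M'.map Prod.fst) (hM' : (M'.map Prod.fst).Nodup) :
    ∃ T : Multiset (Bx n k r × Bx n k r × Bx n k r),
      T.map (fun t => (t.1, t.2.1)) = M ∧ T.map (fun t => (t.2.1, t.2.2)) = M' := by
  have hg : ∀ C, ∃ D, C ∈ M'.map Prod.fst → (C, D) ∈ M' := by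
    intro C
    by_cases hC : C ∈ M'.map Prod.fst
    · obtain ⟨q, hq, rfl⟩ := Multiset.mem_map.1 hC
      exact ⟨q.2, fun _ => hq⟩
    · exact ⟨C, fun h => absurd h hC⟩
  choose g hg using hg
  have e1 : M'.map (fun p => (p.1, g p.1)) = M' := by
    conv_rhs => rw [← Multiset.map_id M']
    refine Multiset.map_congr rfl fun p hp => ?_
    exact inj_on_of_nodup_map hM' _ (hg p.1 (mem_map_of_mem _ hp)) _ hp rfl
  refine ⟨M.map fun p => (p.1, p.2, g p.2), by simp, ?_⟩
  have := congrArg (Multiset.map fun C => (C, g C)) h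
  rw [Multiset.map_map, Multiset.map_map] at this
  rw [Multiset.map_map]
  exact this.trans e1

theorem refines_bind {α : Type*} {sp : Fin n → Fin k → α → α} (i : Fin n) (M : Multiset α) :
    Refines sp M (M.bind (pieces sp i)) := by
  induction M using Multiset.induction with
  | empty => exact .refl _
  | cons a M ih =>
    rw [cons_bind, ← singleton_add]
    exact ((refines_pieces i a).add_right M).trans (ih.add_left _)

theorem exists_refines_card (hk : 2 ≤ k) (i : Fin n) {R : Multiset (Bx n k r)} (hR : R ≠ 0)
    (q : ℕ) : ∃ R', Refines spl R R' ∧ card R' = card R + q * (k - 1) := by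
  induction q with
  | zero => exact ⟨R, .refl _, by simp⟩
  | succ q ih =>
    obtain ⟨R', h1, h2⟩ := ih
    have : 0 < card R' := by
      have := card_pos.2 hR
      omega
    obtain ⟨B, hB⟩ := card_pos_iff_exists_mem.1 this
    obtain ⟨R'', rfl⟩ := exists_cons_of_mem hB
    refine ⟨_, h1.split i, ?_⟩
    rw [card_cons] at h2
    simp only [card_add, card_pieces, add_mul]
    omega

theorem zip_zip {α : Type*} : ∀ l l' l'' : List α, l.length = l'.length → l'.length = l''.length →
    (l.zip (l'.zip l'')).map (fun t => (t.1, t.2.1)) = l.zip l' ∧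
    (l.zip (l'.zip l'')).map (fun t => (t.2.1, t.2.2)) = l'.zip l'' ∧
    (l.zip (l'.zip l'')).map (fun t => (t.1, t.2.2)) = l.zip l''
  | [], [], [], _, _ => by simp
  | a :: l, b :: l', c :: l'', h, h' => by
    have := zip_zip l l' l'' (by simpa using h) (by simpa using h')
    simpa using this

variable {A : Type*} [AddCommGroup A] {val : Multiset (Bx n k r × Bx n k r) → A}

/-- Composition of tables, with the matchings written out. -/
theorem Inv.comp_eq (hv : Inv val) (T : Multiset (Bx n k r × Bx n k r × Bx n k r))
    {M₁ M₂ M₃ : Multiset (Bx n k r × Bx n k r)} (h₁ : IsTab M₁) (h₂ : IsTab M₂)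
    (e₁ : T.map (fun t => (t.1, t.2.1)) = M₁) (e₂ : T.map (fun t => (t.2.1, t.2.2)) = M₂)
    (e₃ : T.map (fun t => (t.1, t.2.2)) = M₃) : val M₃ = val M₁ + val M₂ := by
  subst e₁ e₂ e₃
  refine hv.comp T ?_ ?_ ?_
  · simpa [Multiset.map_map, Function.comp_def] using h₁.1
  · simpa [Multiset.map_map, Function.comp_def] using h₂.1
  · simpa [Multiset.map_map, Function.comp_def] using h₂.2

theorem isTab_diag {P : Multiset (Bx n k r)} (h : IsPart P) : IsTab (diag P) :=
  ⟨by rwa [map_fst_diag], by rwa [map_snd_diag]⟩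

theorem Inv.diag (hv : Inv val) {P : Multiset (Bx n k r)} (h : IsPart P) : val (diag P) = 0 := by
  have := hv.comp_eq (P.map fun B => (B, B, B)) (isTab_diag h) (isTab_diag h) (M₃ := NV.diag P)
    (by simp [NV.diag]) (by simp [NV.diag]) (by simp [NV.diag])
  simpa using this

theorem IsTab.swap {M : Multiset (Bx n k r × Bx n k r)} (h : IsTab M) :
    IsTab (M.map Prod.swap) :=
  ⟨by simpa using h.2, by simpa using h.1⟩

theorem Inv.swap (hv : Inv val) {M : Multiset (Bx n k r × Bx n k r)} (h : IsTab M) :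
    val (M.map Prod.swap) = - val M := by
  have := hv.comp_eq (M.map fun p => (p.1, p.2, p.1)) h h.swap (M₃ := NV.diag (M.map Prod.fst))
    (by simp) (by simp [Prod.swap]) (by simp [NV.diag])
  rw [hv.diag h.1] at this
  exact (neg_eq_of_add_eq_zero_right this.symm).symm

theorem Inv.const (hk : 2 ≤ k) (i : Fin n) (hv : Inv val) {H : Type*}
    (W : H → Multiset (Bx n k r × Bx n k r)) (U : H → Multiset (Bx n k r)) (c : ℕ)
    (hU : ∀ h, card (U h) = c) (hW : ∀ h R, IsPart (U h + R) → IsTab (W h + NV.diag R))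
    (hconj : ∀ h h' R R', IsPart (U h + R) → IsPart (U h' + R') → card R = card R' →
      val (W h + NV.diag R) = val (W h' + NV.diag R')) :
    ∃ a : A, ∀ h R, IsPart (U h + R) → R ≠ 0 → val (W h + NV.diag R) = a := by
  have key : ∀ h h' R R', IsPart (U h + R) → R ≠ 0 → IsPart (U h' + R') → R' ≠ 0 →
      val (W h + NV.diag R) = val (W h' + NV.diag R') := by
    intro h h' R R' hR hR0 hR' hR0'
    obtain ⟨e, e', he⟩ := hR.card_eq hk hR'
    simp only [card_add, hU] at he
    obtain ⟨S, hS, hcS⟩ := exists_refines_card hk i hR0 e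
    obtain ⟨S', hS', hcS'⟩ := exists_refines_card hk i hR0' e'
    have h1 := hv.refines (hW h R hR) ((hS.map (sp' := spl₂) (fun B => (B, B))
      fun _ _ _ => rfl).add_left (W h))
    have h2 := hv.refines (hW h' R' hR') ((hS'.map (sp' := spl₂) (fun B => (B, B))
      fun _ _ _ => rfl).add_left (W h'))
    exact h1.symm.trans ((hconj h h' S S' (hR.refines (hS.add_left _))
      (hR'.refines (hS'.add_left _)) (by omega)).trans h2)
  by_cases hex : ∃ h R, IsPart (U h + R) ∧ R ≠ 0
  · obtain ⟨h, R, h1, h2⟩ := hex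
    exact ⟨_, fun h' R' h1' h2' => key h' h R' R h1' h2' h1 h2⟩
  · exact ⟨0, fun h R h1 h2 => absurd ⟨h, R, h1, h2⟩ hex⟩

theorem Inv.exists_swap (hk : 2 ≤ k) (i : Fin n) (hv : Inv val) :
    ∃ ε : A, ∀ B C R, IsPart ({B, C} + R) → R ≠ 0 → val (swapTab B C R) = ε := by
  obtain ⟨ε, hε⟩ := hv.const hk i (fun h : Bx n k r × Bx n k r => {(h.1, h.2), (h.2, h.1)})
    (fun h => {h.1, h.2}) 2 (by simp) (fun h R hR => hR.swapTab) (by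
      rintro ⟨B, C⟩ ⟨B', C'⟩ R R' h h' hc
      obtain ⟨Z, rfl, rfl⟩ := exists_matching hc
      dsimp only at h h' ⊢
      have t1 : IsTab ({(B, B'), (C, C')} + Z) := ⟨by simpa using h, by simpa using h'⟩
      have e1 := hv.comp_eq ({(B, C, C'), (C, B, B')} + Z.map fun p => (p.1, p.1, p.2))
        h.swapTab t1 (M₃ := {(B, C'), (C, B')} + Z) (by simp [swapTab, NV.diag])
        (by simp [cons_swap (C, C')]) (by simp)
      have e2 := hv.comp_eq ({(B, B', C'), (C, C', B')} + Z.map fun p => (p.1, p.2, p.2))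
        t1 h'.swapTab (M₃ := {(B, C'), (C, B')} + Z) (by simp)
        (by simp [swapTab, NV.diag]) (by simp)
      rw [e1, add_comm] at e2
      exact add_left_cancel e2)
  exact ⟨ε, fun B C R h hR => hε (B, C) R h hR⟩

theorem Inv.exists_turn (hk : 2 ≤ k) (i i' : Fin n) (hv : Inv val) :
    ∃ b : A, ∀ B R, IsPart (B ::ₘ R) → R ≠ 0 → val (turn i i' B + NV.diag R) = b := by
  refine hv.const hk i (turn i i') (fun B => {B}) 1 (by simp) (fun h R hR => hR.turn i i') ?_
  intro B B' R R' h h' hc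
  rw [singleton_add] at h h'
  obtain ⟨Z, rfl, rfl⟩ := exists_matching hc
  have t : IsTab ((B, B') ::ₘ Z) := ⟨by simpa using h, by simpa using h'⟩
  have ti : ∀ i, IsTab (pieces spl₂ i (B, B') + Z) := fun i =>
    t.refines ((Refines.refl _).split i)
  have e1 := hv.comp_eq ((Finset.univ : Finset (Fin k)).val.map
      (fun j => (spl i j B, spl i' j B, spl i' j B')) + Z.map fun p => (p.1, p.1, p.2))
    (h.turn i i') (ti i')
    (M₃ := (Finset.univ : Finset (Fin k)).val.map (fun j => (spl i j B, spl i' j B')) + Z)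
    (by simp only [turn, NV.diag, Multiset.map_add, Multiset.map_map, Function.comp_def])
    (by simp only [pieces, spl₂, Multiset.map_add, Multiset.map_map, Function.comp_def,
      Prod.mk.eta, map_id'])
    (by simp only [Multiset.map_add, Multiset.map_map, Function.comp_def, Prod.mk.eta, map_id'])
  have e2 := hv.comp_eq ((Finset.univ : Finset (Fin k)).val.map
      (fun j => (spl i j B, spl i j B', spl i' j B')) + Z.map fun p => (p.1, p.2, p.2))
    (ti i) (h'.turn i i')
    (M₃ := (Finset.univ : Finset (Fin k)).val.map (fun j => (spl i j B, spl i' j B')) + Z)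
    (by simp only [pieces, spl₂, Multiset.map_add, Multiset.map_map, Function.comp_def,
      Prod.mk.eta, map_id'])
    (by simp only [turn, NV.diag, Multiset.map_add, Multiset.map_map, Function.comp_def])
    (by simp only [Multiset.map_add, Multiset.map_map, Function.comp_def, Prod.mk.eta, map_id'])
  rw [e1, hv.split i t, hv.split i' t, add_comm] at e2
  exact add_left_cancel e2

section Generation

variable {S : AddSubgroup A}

theorem Inv.perm_mem (hv : Inv val)
    (hS : ∀ B C R, IsPart ({B, C} + R) → R ≠ 0 → val (swapTab B C R) ∈ S)
    {l l' : List (Bx n k r)} (h : l.Perm l') : ∀ K : Multiset (Bx n k r),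
      IsPart ((l : Multiset (Bx n k r)) + K) → 3 ≤ l.length + card K →
      val ((l.zip l' : Multiset (Bx n k r × Bx n k r)) + NV.diag K) ∈ S := by
  induction h with
  | nil =>
    intro K hK _
    rw [List.zip_nil_left, coe_nil, zero_add] at *
    rw [hv.diag hK]
    exact S.zero_mem
  | cons a h ih =>
    intro K hK hc
    rw [← cons_coe, cons_add, ← add_cons] at hK
    have := ih (a ::ₘ K) hK (by simp at hc ⊢; omega)
    rwa [diag_cons, add_cons, ← cons_add, cons_coe] at this
  | swap a b l =>
    intro K hK hc
    have h0 : (l : Multiset (Bx n k r)) + K ≠ 0 := by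
      rw [← card_pos]
      simp at hc ⊢
      omega
    have hba : ((b :: a :: l : List _) : Multiset (Bx n k r)) = {b, a} + ↑l := rfl
    rw [hba, add_assoc] at hK
    have := hS b a ((l : Multiset (Bx n k r)) + K) hK h0
    have hz : (l.zip l : Multiset (Bx n k r × Bx n k r)) = NV.diag (l : Multiset (Bx n k r)) := by
      rw [NV.diag, map_coe]
      congr 1
      clear * -
      induction l with
      | nil => rfl
      | cons a l ih => simp [ih]
    rwa [swapTab, diag_add, ← hz, ← add_assoc] at this
  | @trans l l' l'' h h' ih ih' =>
    intro K hK hc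
    have hK' : IsPart ((l' : Multiset (Bx n k r)) + K) := by rwa [← coe_eq_coe.2 h]
    have hK'' : IsPart ((l'' : Multiset (Bx n k r)) + K) := by rwa [← coe_eq_coe.2 h']
    have e1 := h.length_eq
    have e2 := h'.length_eq
    obtain ⟨z1, z2, z3⟩ := zip_zip l l' l'' e1 e2
    have := hv.comp_eq
      ((l.zip (l'.zip l'') : Multiset (Bx n k r × Bx n k r × Bx n k r)) + K.map fun B => (B, B, B))
      (M₁ := (l.zip l' : Multiset (Bx n k r × Bx n k r)) + NV.diag K)
      (M₂ := (l'.zip l'' : Multiset (Bx n k r × Bx n k r)) + NV.diag K)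
      (M₃ := (l.zip l'' : Multiset (Bx n k r × Bx n k r)) + NV.diag K)
      ⟨by simpa [map_fst_diag, List.map_fst_zip, e1] using hK,
        by simpa [map_snd_diag, List.map_snd_zip, e1] using hK'⟩
      ⟨by simpa [map_fst_diag, List.map_fst_zip, e2] using hK',
        by simpa [map_snd_diag, List.map_snd_zip, e2] using hK''⟩
      (by simp [NV.diag, z1]) (by simp [NV.diag, z2]) (by simp [NV.diag, z3])
    rw [this]
    exact S.add_mem (ih K hK hc) (ih' K hK' (by omega))

theorem Inv.mem_of_map_eq (hv : Inv val)
    (hS : ∀ B C R, IsPart ({B, C} + R) → R ≠ 0 → val (swapTab B C R) ∈ S)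
    {M : Multiset (Bx n k r × Bx n k r)} (hM : IsTab M) (hc : 3 ≤ card M)
    (h : M.map Prod.fst = M.map Prod.snd) : val M ∈ S := by
  induction M using Quotient.inductionOn with
  | h L =>
    simp only [quot_mk_to_coe, map_coe, coe_eq_coe, coe_card] at *
    have := hv.perm_mem hS h 0 (by simpa using hM.1) (by simpa using hc)
    have hz : (L.map Prod.fst).zip (L.map Prod.snd) = L := by
      clear * -
      induction L with
      | nil => rfl
      | cons a L ih => simp [ih]
    rw [hz] at this
    simpa [NV.diag] using this

theorem Inv.mem_of_mem (hk : 2 ≤ k) (hv : Inv val)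
    (hS : ∀ B C R, IsPart ({B, C} + R) → R ≠ 0 → val (swapTab B C R) ∈ S)
    {M M' : Multiset (Bx n k r × Bx n k r)} (hM : IsTab M) (hc : 3 ≤ card M)
    (h₁ : M.map Prod.fst = M'.map Prod.fst) (h₂ : M.map Prod.snd = M'.map Prod.snd)
    (h : val M ∈ S) : val M' ∈ S := by
  have hM' : IsTab M' := ⟨h₁ ▸ hM.1, h₂ ▸ hM.2⟩
  obtain ⟨T, h12, h23⟩ := exists_comp (M := M') (M' := M.map Prod.swap) (by simp [← h₂])
    (by simpa using hM.2.nodup hk)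
  have e := hv.comp_eq T hM' hM.swap h12 h23 rfl
  have hT1 : T.map (fun t => t.1) = M.map Prod.fst := by
    rw [h₁, ← h12]; simp
  have hT2 : T.map (fun t => t.2.2) = M.map Prod.fst := by
    have := congrArg (Multiset.map Prod.snd) h23
    simpa using this
  have hin : val (T.map fun t => (t.1, t.2.2)) ∈ S := by
    refine hv.mem_of_map_eq hS ⟨?_, ?_⟩ ?_ ?_
    · simpa [hT1] using hM.1
    · simpa [hT2] using hM.1
    · have := congrArg card hT1
      simp only [card_map] at this ⊢
      omega
    · simp [hT1, hT2]
  rw [e, hv.swap hM] at hin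
  simpa using S.add_mem hin h

theorem Inv.mem_of_refines (hk : 2 ≤ k) (hv : Inv val)
    (hS : ∀ B C R, IsPart ({B, C} + R) → R ≠ 0 → val (swapTab B C R) ∈ S)
    (hS' : ∀ i i' B R, IsPart (B ::ₘ R) → R ≠ 0 → val (turn i i' B + NV.diag R) ∈ S)
    {P₀ : Multiset (Bx n k r)} (hP₀ : IsPart P₀) (hc : 3 ≤ card P₀) {P : Multiset (Bx n k r)}
    (hP : Refines spl P₀ P) : ∀ M : Multiset (Bx n k r × Bx n k r), M.map Prod.fst = P →
      Refines spl P₀ (M.map Prod.snd) → val M ∈ S := by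
  have big : ∀ {Q}, Refines spl P₀ Q → card P₀ ≤ card Q := fun h => by
    obtain ⟨e, he⟩ := h.card_modEq (by omega)
    omega
  induction hP with
  | refl =>
    intro M h1 h2
    generalize hQ : M.map Prod.snd = Q at h2
    have hcM := congrArg card h1
    have hcQ := congrArg card hQ
    rw [card_map] at hcM hcQ
    cases h2 with
    | refl =>
      refine hv.mem_of_map_eq hS ⟨?_, ?_⟩ (by omega) (h1.trans hQ.symm)
      · rwa [h1]
      · rwa [hQ]
    | split i h2 =>
      have := big h2
      simp only [card_add, card_pieces, card_cons] at *
      omega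
  | @split B R i hP ih =>
    intro M h1 h2
    generalize hQ : M.map Prod.snd = Q at h2
    have hcM := congrArg card h1
    have hcQ := congrArg card hQ
    have hbP := big hP
    simp only [card_add, card_pieces, card_map, card_cons] at hcM hcQ hbP
    cases h2 with
    | refl => omega
    | @split B' R' i' h2 =>
      simp only [card_add, card_pieces] at hcQ
      obtain ⟨Z, rfl, rfl⟩ := exists_matching (P := R) (Q := R') (by omega)
      have t0 : IsTab ((B, B') ::ₘ Z) :=
        ⟨by simpa using hP₀.refines hP, by simpa using hP₀.refines h2⟩
      have m0 := ih ((B, B') ::ₘ Z) (by simp) (by simpa using h2)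
      rw [← hv.split i t0] at m0
      have t1 : IsTab (pieces spl₂ i (B, B') + Z) := t0.refines ((Refines.refl _).split i)
      have hB' : IsPart (B' ::ₘ Z.map Prod.snd) := hP₀.refines h2
      have e := hv.comp_eq ((Finset.univ : Finset (Fin k)).val.map
          (fun j => (spl i j B, spl i j B', spl i' j B')) + Z.map fun p => (p.1, p.2, p.2))
        t1 (hB'.turn i i')
        (M₃ := (Finset.univ : Finset (Fin k)).val.map (fun j => (spl i j B, spl i' j B')) + Z)
        (by simp only [pieces, spl₂, Multiset.map_add, Multiset.map_map, Function.comp_def,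
          Prod.mk.eta, map_id'])
        (by simp only [turn, NV.diag, Multiset.map_add, Multiset.map_map, Function.comp_def])
        (by simp only [Multiset.map_add, Multiset.map_map, Function.comp_def, Prod.mk.eta,
          map_id'])
      have m1 := S.add_mem m0 (hS' i i' B' (Z.map Prod.snd) hB' (by
        rw [← card_pos]
        simp only [card_map] at *
        omega))
      rw [← e] at m1
      have f1 : ((Finset.univ : Finset (Fin k)).val.map (fun j => (spl i j B, spl i' j B')) +
          Z).map Prod.fst = M.map Prod.fst := by
        rw [h1]
        simp only [pieces, Multiset.map_add, Multiset.map_map, Function.comp_def]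
      have f2 : ((Finset.univ : Finset (Fin k)).val.map (fun j => (spl i j B, spl i' j B')) +
          Z).map Prod.snd = M.map Prod.snd := by
        rw [hQ]
        simp only [pieces, Multiset.map_add, Multiset.map_map, Function.comp_def]
      refine hv.mem_of_mem hk hS ⟨?_, ?_⟩ ?_ f1 f2 m1
      · rw [f1, h1]
        exact (hP₀.refines hP).pieces_add i
      · rw [f2, hQ]
        exact hB'.pieces_add i'
      · have := congrArg card f1
        simp only [card_map, card_add] at *
        omega

/-- The invariant of every table lies in the subgroup generated by the invariants of exchanges
of two boxes and of turns of a box. -/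
theorem Inv.mem (hk : 2 ≤ k) (hv : Inv val)
    (hS : ∀ B C R, IsPart ({B, C} + R) → R ≠ 0 → val (swapTab B C R) ∈ S)
    (hS' : ∀ i i' B R, IsPart (B ::ₘ R) → R ≠ 0 → val (turn i i' B + NV.diag R) ∈ S)
    {P₀ : Multiset (Bx n k r)} (hP₀ : IsPart P₀) (hc : 3 ≤ card P₀)
    {M : Multiset (Bx n k r × Bx n k r)} (hM : IsTab M) : val M ∈ S := by
  have uni : ∀ {P Q : Multiset (Bx n k r)} {N : ℕ}, IsPart P → IsPart Q →
      (∀ B ∈ P, ∀ i, len B i ≤ N) → (∀ B ∈ Q, ∀ i, len B i = N) → Refines spl P Q := by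
    intro P Q N hP hQ hPN hQN
    obtain ⟨P', h1, h2⟩ := exists_refines_uniform len len_spl N P hPN
    rwa [← (hP.refines h1).eq_of_len_eq hk hQ h2 hQN]
  obtain ⟨N₀, hN₀⟩ := exists_bound len P₀
  obtain ⟨N₁, hN₁⟩ := exists_bound (fun p : Bx n k r × Bx n k r => len p.1) M
  obtain ⟨M₁, h1, h1'⟩ := exists_refines_uniform (fun p : Bx n k r × Bx n k r => len p.1)
    (sp := spl₂) (fun i j p => len_spl i j p.1) (max N₀ N₁) M (hN₁ _ (le_max_right _ _))
  have hM₁ := hM.refines h1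
  obtain ⟨N₂, hN₂⟩ := exists_bound (fun p : Bx n k r × Bx n k r => len p.2) M₁
  obtain ⟨M₂, h2, h2'⟩ := exists_refines_uniform (fun p : Bx n k r × Bx n k r => len p.2)
    (sp := spl₂) (fun i j p => len_spl i j p.2) (max N₀ N₂) M₁ (hN₂ _ (le_max_right _ _))
  have hM₂ := hM₁.refines h2
  rw [← hv.refines hM h1, ← hv.refines hM₁ h2]
  refine hv.mem_of_refines hk hS hS' hP₀ hc
    ((uni hP₀ hM₁.1 (hN₀ _ (le_max_left N₀ N₁)) ?_).trans
      (h2.map Prod.fst fun _ _ _ => rfl)) _ rfl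
    (uni hP₀ hM₂.2 (hN₀ _ (le_max_left N₀ N₂)) ?_)
  · intro B hB
    obtain ⟨p, hp, rfl⟩ := Multiset.mem_map.1 hB
    exact h1' p hp
  · intro B hB
    obtain ⟨p, hp, rfl⟩ := Multiset.mem_map.1 hB
    exact h2' p hp

end Generation

end Elementary

section Basic

variable {n k r : ℕ}

variable {A : Type*} [AddCommGroup A] {val : Multiset (Bx n k r × Bx n k r) → A}

section Relations

variable {ε : A} {b : Fin n → Fin n → A}

theorem Inv.two_nsmul_swap (hv : Inv val)
    (hε : ∀ B C R, IsPart ({B, C} + R) → R ≠ 0 → val (swapTab B C R) = ε)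
    {B C : Bx n k r} {R : Multiset (Bx n k r)} (h : IsPart ({B, C} + R)) (hR : R ≠ 0) :
    2 • ε = 0 := by
  have e := hv.swap h.swapTab
  have : (swapTab B C R).map Prod.swap = swapTab B C R := by
    simp [swapTab, NV.diag, cons_swap (C, B)]
  rw [this, hε B C R h hR] at e
  rw [two_nsmul]
  exact add_eq_zero_iff_eq_neg.2 e

theorem Inv.turn_add (hv : Inv val)
    (hb : ∀ i i' B R, IsPart (B ::ₘ R) → R ≠ 0 → val (turn i i' B + NV.diag R) = b i i')
    {B : Bx n k r} {R : Multiset (Bx n k r)} (h : IsPart (B ::ₘ R)) (hR : R ≠ 0)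
    (i i' i'' : Fin n) : b i i'' = b i i' + b i' i'' := by
  rw [← hb i i' B R h hR, ← hb i' i'' B R h hR, ← hb i i'' B R h hR]
  refine hv.comp_eq ((Finset.univ : Finset (Fin k)).val.map
      (fun j => (spl i j B, spl i' j B, spl i'' j B)) + R.map fun D => (D, D, D))
    (h.turn i i') (h.turn i' i'') ?_ ?_ ?_ <;>
  simp only [turn, NV.diag, Multiset.map_add, Multiset.map_map, Function.comp_def]

theorem Inv.multi_swap (hv : Inv val)
    (hε : ∀ B C R, IsPart ({B, C} + R) → R ≠ 0 → val (swapTab B C R) = ε)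
    (L : Multiset (Bx n k r × Bx n k r)) : ∀ R : Multiset (Bx n k r),
      IsPart (L.map Prod.fst + L.map Prod.snd + R) → R ≠ 0 →
      val (L + L.map Prod.swap + NV.diag R) = card L • ε := by
  induction L using Multiset.induction with
  | empty =>
    intro R h _
    simp only [Multiset.map_zero, zero_add] at h ⊢
    simp [hv.diag h]
  | cons p L ih =>
    obtain ⟨X, Y⟩ := p
    intro R h hR
    have h1 : IsPart ({X, Y} + (L.map Prod.fst + L.map Prod.snd + R)) := by
      simpa [add_cons, cons_add, cons_swap] using h
    have h2 : IsPart (L.map Prod.fst + L.map Prod.snd + (X ::ₘ Y ::ₘ R)) := by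
      simpa [add_cons, cons_add] using h1
    have hR1 : L.map Prod.fst + L.map Prod.snd + R ≠ 0 := by
      rw [← card_pos] at hR ⊢
      simp only [card_add]
      omega
    rw [card_cons, succ_nsmul', ← ih (X ::ₘ Y ::ₘ R) h2 (by simp), ← hε X Y _ h1 hR1]
    refine hv.comp_eq ((X, Y, Y) ::ₘ (Y, X, X) ::ₘ (L.map (fun p => (p.1, p.1, p.2)) +
      L.map (fun p => (p.2, p.2, p.1)) + R.map fun D => (D, D, D))) h1.swapTab
      (M₂ := L + L.map Prod.swap + NV.diag (X ::ₘ Y ::ₘ R)) ⟨?_, ?_⟩ ?_ ?_ ?_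
    · simpa [NV.diag, Multiset.map_map, Function.comp_def] using h2
    · simpa [NV.diag, Multiset.map_map, Function.comp_def, add_comm (L.map Prod.snd)] using h2
    · simp [swapTab, NV.diag]
    · simp only [NV.diag, Multiset.map_add, Multiset.map_map, Multiset.map_cons,
        Function.comp_def, Prod.mk.eta, map_id', add_cons, Prod.swap]
      exact cons_swap _ _ _
    · simp only [NV.diag, Multiset.map_add, Multiset.map_map, Multiset.map_cons,
        Function.comp_def, Prod.mk.eta, map_id', add_cons, cons_add, Prod.swap]
      exact cons_swap _ _ _

theorem Inv.card_nsmul_swap (hv : Inv val)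
    (hε : ∀ B C R, IsPart ({B, C} + R) → R ≠ 0 → val (swapTab B C R) = ε) (i : Fin n)
    {B C : Bx n k r} {R : Multiset (Bx n k r)} (h : IsPart ({B, C} + R)) (hR : R ≠ 0) :
    k • ε = ε := by
  have hsw : (pieces spl₂ i (B, C)).map Prod.swap = pieces spl₂ i (C, B) :=
    map_pieces (sp := spl₂) (sp' := spl₂) Prod.swap (fun _ _ _ => rfl) i (B, C)
  have hr : Refines spl₂ (swapTab B C R)
      (pieces spl₂ i (B, C) + pieces spl₂ i (C, B) + NV.diag R) := by
    refine (((refines_pieces i (B, C)).add_right {(C, B)}).trans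
      ((refines_pieces i (C, B)).add_left _)).add_right (NV.diag R)
  have ht := h.swapTab.refines hr
  have e := hv.refines h.swapTab hr
  rw [hε B C R h hR, ← hsw, hv.multi_swap hε _ R ?_ hR, card_pieces] at e
  · exact e
  · have := ht.1
    rw [← hsw] at this
    simpa only [Multiset.map_add, Multiset.map_map, Function.comp_def, Prod.fst_swap,
      map_fst_diag] using this

theorem IsPart.bind_pieces {L R : Multiset (Bx n k r)} (h : IsPart (L + R)) (i : Fin n) :
    IsPart (L.bind (pieces spl i) + R) :=
  h.refines ((refines_bind i L).add_right R)

theorem map_fst_bind_turn (i i' : Fin n) (L : Multiset (Bx n k r)) :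
    (L.bind (turn i i')).map Prod.fst = L.bind (pieces spl i) := by
  simp only [Multiset.map_bind, map_fst_turn]

theorem map_snd_bind_turn (i i' : Fin n) (L : Multiset (Bx n k r)) :
    (L.bind (turn i i')).map Prod.snd = L.bind (pieces spl i') := by
  simp only [Multiset.map_bind, map_snd_turn]

theorem IsPart.bind_turn {L R : Multiset (Bx n k r)} (h : IsPart (L + R)) (i i' : Fin n) :
    IsTab (L.bind (NV.turn i i') + diag R) :=
  ⟨by simpa only [Multiset.map_add, map_fst_bind_turn, map_fst_diag] using h.bind_pieces i,
    by simpa only [Multiset.map_add, map_snd_bind_turn, map_snd_diag] using h.bind_pieces i'⟩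

theorem Inv.multi_turn (hv : Inv val)
    (hb : ∀ i i' B R, IsPart (B ::ₘ R) → R ≠ 0 → val (turn i i' B + NV.diag R) = b i i')
    (i i' : Fin n) (L : Multiset (Bx n k r)) : ∀ R : Multiset (Bx n k r),
      IsPart (L + R) → R ≠ 0 →
      val (L.bind (turn i i') + NV.diag R) = card L • b i i' := by
  induction L using Multiset.induction with
  | empty =>
    intro R h _
    rw [zero_add] at h
    simp [hv.diag h]
  | cons X L ih =>
    intro R h hR
    have h1 : IsPart (X ::ₘ (L.bind (pieces spl i) + R)) := by
      have : IsPart (L + (X ::ₘ R)) := by rwa [add_cons, ← cons_add]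
      simpa only [add_cons] using this.bind_pieces i
    have h2 : IsPart (L + (pieces spl i' X + R)) := by
      have : IsPart (X ::ₘ (L + R)) := by rwa [← cons_add]
      rw [add_left_comm]
      exact this.pieces_add i'
    have hR1 : L.bind (pieces spl i) + R ≠ 0 := by
      rw [← card_pos] at hR ⊢
      simp only [card_add]
      omega
    have hR2 : pieces spl i' X + R ≠ 0 := by
      rw [← card_pos] at hR ⊢
      simp only [card_add]
      omega
    have hturn : (turn i i' : Bx n k r → _) = fun Z =>
      (Finset.univ : Finset (Fin k)).val.map fun j => (spl i j Z, spl i' j Z) := rfl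
    rw [card_cons, succ_nsmul', ← ih _ h2 hR2, ← hb i i' X _ h1 hR1]
    refine hv.comp_eq ((Finset.univ : Finset (Fin k)).val.map
        (fun j => (spl i j X, spl i' j X, spl i' j X)) +
      L.bind (fun Z => (Finset.univ : Finset (Fin k)).val.map
        fun j => (spl i j Z, spl i j Z, spl i' j Z)) + R.map fun D => (D, D, D))
      (h1.turn i i') (h2.bind_turn i i') ?_ ?_ ?_
    · simp only [turn, NV.diag, pieces, Multiset.map_add, Multiset.map_map, Multiset.map_bind,
        Function.comp_def, add_assoc]
    · simp only [hturn, NV.diag, pieces, Multiset.map_add, Multiset.map_map, Multiset.map_bind,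
        Function.comp_def, add_assoc]
      exact add_left_comm _ _ _
    · simp only [hturn, NV.diag, Multiset.map_add, Multiset.map_map, Multiset.map_bind,
        Function.comp_def, cons_bind]

theorem Inv.turn_add_nsmul_turn (hv : Inv val)
    (hε : ∀ B C R, IsPart ({B, C} + R) → R ≠ 0 → val (swapTab B C R) = ε)
    (hb : ∀ i i' B R, IsPart (B ::ₘ R) → R ≠ 0 → val (turn i i' B + NV.diag R) = b i i')
    {i i' : Fin n} (hi : i ≠ i') {B : Bx n k r} {R : Multiset (Bx n k r)} (h : IsPart (B ::ₘ R))
    (hR : R ≠ 0) : ∃ c, 2 * c + k = k * k ∧ b i i' + k • b i' i = c • ε := by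
  let lt := Finset.univ.filter fun p : Fin k × Fin k => p.1 < p.2
  let gt := Finset.univ.filter fun p : Fin k × Fin k => p.2 < p.1
  let eq := Finset.univ.filter fun p : Fin k × Fin k => p.1 = p.2
  have hgt : gt.val = lt.val.map Prod.swap := by
    have : gt = lt.map (Equiv.prodComm _ _).toEmbedding := by
      ext ⟨a, c⟩
      simp [gt, lt]
    rw [this]
    rfl
  have huniv : (Finset.univ : Finset (Fin k × Fin k)).val = lt.val + lt.val.map Prod.swap +
      eq.val := by
    rw [← hgt]
    have e1 : Finset.univ = (lt.disjUnion gt (by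
        rw [Finset.disjoint_left]; simp [lt, gt]; omega)).disjUnion eq (by
        rw [Finset.disjoint_left]; simp [lt, gt, eq]) := by
      ext ⟨a, c⟩
      simp only [lt, gt, eq, Finset.mem_univ, Finset.mem_disjUnion, Finset.mem_filter, true_and,
        true_iff]
      omega
    rw [e1]
    rfl
  have heq : eq.card = k := by
    have : eq = Finset.univ.image fun a : Fin k => (a, a) := by
      ext ⟨a, c⟩
      simp [eq]
    rw [this, Finset.card_image_of_injective _ fun a c h => (Prod.mk.inj h).1]
    simp
  have hcard : 2 * lt.card + k = k * k := by
    have := congrArg card huniv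
    simp only [card_add, card_map, Finset.card_val, Finset.card_univ, Fintype.card_prod,
      Fintype.card_fin, heq] at this
    omega
  refine ⟨lt.card, hcard, ?_⟩
  let g : Fin k × Fin k → Bx n k r := fun p => spl i' p.2 (spl i p.1 B)
  have hprod : ∀ {β : Type} (f : Fin k × Fin k → β),
      (Finset.univ : Finset (Fin k)).val.bind (fun j =>
        (Finset.univ : Finset (Fin k)).val.map fun c => f (j, c)) =
      (Finset.univ : Finset (Fin k × Fin k)).val.map f := by
    intro β f
    have : (Finset.univ : Finset (Fin k × Fin k)).val =
      (Finset.univ : Finset (Fin k)).val ×ˢ (Finset.univ : Finset (Fin k)).val := rfl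
    rw [this]
    change _ = map f (Multiset.product _ _)
    simp only [Multiset.product, Multiset.map_bind, Multiset.map_map, Function.comp_def]
  have hP := h.pieces_add i'
  have ht := h.turn i i'
  have hr : Refines spl₂ (turn i i' B + NV.diag R)
    ((turn i i' B).bind (pieces spl₂ i') + NV.diag R) := (refines_bind _ _).add_right _
  have hcomp : val ((Finset.univ : Finset (Fin k × Fin k)).val.map
      (fun p => (g p, g p.swap)) + NV.diag R) = b i i' + k • b i' i := by
    have e1 := hv.multi_turn hb i' i (pieces spl i' B) R hP hR
    rw [card_pieces] at e1
    rw [← e1, ← hb i i' B R h hR, ← hv.refines ht hr, ← hprod]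
    refine hv.comp_eq ((Finset.univ : Finset (Fin k)).val.bind (fun j =>
        (Finset.univ : Finset (Fin k)).val.map fun c =>
          (spl i' c (spl i j B), spl i' c (spl i' j B), spl i c (spl i' j B))) +
        R.map fun D => (D, D, D)) (ht.refines hr) (hP.bind_turn i' i) ?_ ?_ ?_
    · simp only [turn, NV.diag, pieces, spl₂, Multiset.map_add, Multiset.map_map,
        Multiset.map_bind, Multiset.bind_map, Function.comp_def]
    · simp only [turn, NV.diag, pieces, Multiset.map_add, Multiset.map_map,
        Multiset.map_bind, Multiset.bind_map, Function.comp_def]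
    · simp only [g, NV.diag, Multiset.map_add, Multiset.map_map,
        Multiset.map_bind, Function.comp_def, Prod.swap, spl_comm hi]
  have hpart : IsPart ((Finset.univ : Finset (Fin k × Fin k)).val.map g + R) := by
    have := (ht.refines hr).1
    rw [← hprod g]
    simpa only [turn, pieces, spl₂, Multiset.map_add, Multiset.map_map, Multiset.map_bind,
      Multiset.bind_map, Function.comp_def, map_fst_diag] using this
  rw [← hcomp]
  have hsw := hv.multi_swap hε (lt.val.map fun p => (g p, g p.swap)) (eq.val.map g + R) (by
    rw [huniv] at hpart
    simpa only [Multiset.map_add, Multiset.map_map, Function.comp_def, add_assoc] using hpart) (by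
    rw [← card_pos] at hR ⊢
    simp only [card_add]
    omega)
  rw [card_map, Finset.card_val] at hsw
  rw [← hsw, huniv]
  congr 1
  have hd : eq.val.map (fun p => (g p, g p.swap)) = NV.diag (eq.val.map g) := by
    rw [NV.diag, Multiset.map_map]
    refine Multiset.map_congr rfl fun p hp => ?_
    have : p.1 = p.2 := by simpa [eq] using hp
    obtain ⟨a, c⟩ := p
    obtain rfl : a = c := this
    rfl
  simp only [Multiset.map_add, Multiset.map_map, Function.comp_def, hd, diag_add, add_assoc,
    Prod.swap_swap, Prod.swap_prod_mk]

/-- The multiples of the invariant of a turn by `k - 1`. -/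
theorem Inv.nsmul_turn (hk : 2 ≤ k) (hv : Inv val)
    (hε : ∀ B C R, IsPart ({B, C} + R) → R ≠ 0 → val (swapTab B C R) = ε)
    (hb : ∀ i i' B R, IsPart (B ::ₘ R) → R ≠ 0 → val (turn i i' B + NV.diag R) = b i i')
    {i i' : Fin n} (hi : i ≠ i') {B C : Bx n k r} {R : Multiset (Bx n k r)}
    (h : IsPart ({B, C} + R)) (hR : R ≠ 0) :
    ∃ c, 2 * c + k = k * k ∧ (k - 1) • b i i' = c • ε := by
  have h' : IsPart (B ::ₘ (C ::ₘ R)) := by simpa using h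
  obtain ⟨c, hc, e⟩ := hv.turn_add_nsmul_turn hε hb hi h' (by simp)
  refine ⟨c, hc, ?_⟩
  have e1 := hv.turn_add hb h' (by simp) i i i
  have e2 := hv.turn_add hb h' (by simp) i i' i
  have e3 := hv.two_nsmul_swap hε h hR
  rw [left_eq_add] at e1
  rw [e1] at e2
  have e4 : b i' i = - b i i' := (neg_eq_of_add_eq_zero_right e2.symm).symm
  obtain ⟨d, rfl⟩ := Nat.exists_eq_add_of_le' (by omega : 1 ≤ k)
  have e5 : c • ε + c • ε = 0 := by rw [← two_nsmul, nsmul_left_comm, e3, nsmul_zero]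
  have e6 : d • b i i' = -(c • ε) := by
    rw [← e, e4]
    module
  rw [Nat.add_sub_cancel, e6]
  exact neg_eq_of_add_eq_zero_left e5

end Relations

end Basic

section Invariants

variable {n k r : ℕ}

/-- The total change of the word lengths in one direction, modulo `k - 1`. -/
def lenVal (l : Fin n) (M : Multiset (Bx n k r × Bx n k r)) : ZMod (k - 1) :=
  (M.map fun p => (len p.2 l : ZMod (k - 1)) - len p.1 l).sum

theorem card_nsmul_zmod (hk : 2 ≤ k) (x : ZMod (k - 1)) : k • x = x := by
  obtain ⟨d, rfl⟩ := Nat.exists_eq_add_of_le' (by omega : 1 ≤ k)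
  have h (x : ZMod d) : (d + 1) • x = x := by simp
  exact h x

theorem len_spl_cast {R : Type*} [AddCommMonoidWithOne R] (i l : Fin n) (j : Fin k)
    (B : Bx n k r) : (len (spl i j B) l : R) = len B l + if l = i then 1 else 0 := by
  rw [len_spl, Function.update_apply]
  split_ifs with h
  · simp [h]
  · simp

theorem lenVal_turn (hk : 2 ≤ k) (i i' : Fin n) (B C : Bx n k r) (l : Fin n) :
    lenVal l ((Finset.univ : Finset (Fin k)).val.map fun j => (spl i j B, spl i' j C)) =
      ((len C l : ZMod (k - 1)) - len B l) +
        ((if l = i' then 1 else 0) - if l = i then 1 else 0) := by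
  simp only [lenVal, Multiset.map_map, Function.comp_def, len_spl_cast]
  rw [Multiset.map_const', sum_replicate, Finset.card_val, Finset.card_univ, Fintype.card_fin,
    card_nsmul_zmod hk]
  ring

theorem lenVal_add (l : Fin n) (M M' : Multiset (Bx n k r × Bx n k r)) :
    lenVal l (M + M') = lenVal l M + lenVal l M' := by
  simp [lenVal]

theorem lenVal_diag (l : Fin n) (R : Multiset (Bx n k r)) : lenVal l (diag R) = 0 := by
  simp [lenVal, diag]

theorem lenVal_swapTab (l : Fin n) (B C : Bx n k r) (R : Multiset (Bx n k r)) :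
    lenVal l (swapTab B C R) = 0 := by
  rw [swapTab, lenVal_add, lenVal_diag]
  simp [lenVal]

theorem inv_lenVal (hk : 2 ≤ k) (l : Fin n) :
    Inv (lenVal l : Multiset (Bx n k r × Bx n k r) → ZMod (k - 1)) where
  split := by
    rintro ⟨B, C⟩ R i -
    have := lenVal_turn hk i i B C l
    rw [sub_self, add_zero] at this
    rw [lenVal_add, ← singleton_add, lenVal_add]
    congr 1
    exact this.trans (by simp [lenVal])
  comp := by
    intro T _ _ _
    simp only [lenVal, Multiset.map_map, Function.comp_def, ← sum_map_add]
    congr 1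
    refine Multiset.map_congr rfl fun t _ => ?_
    ring

/-- The sum of the letters of a word, modulo two. -/
def letterSum (u : List (Fin k)) : ZMod 2 := (u.map fun a => (a.val : ZMod 2)).sum

/-- Whether two words are comparable. -/
def eqVal : List (Fin k) → List (Fin k) → ZMod 2
  | [], _ => 1
  | _ :: _, [] => 1
  | a :: u, b :: v => if a = b then eqVal u v else 0

/-- An additive extension of the lexicographic order on incomparable words. -/
def ltVal : List (Fin k) → List (Fin k) → ZMod 2
  | [], v => letterSum v
  | a :: u, [] => letterSum (a :: u)
  | a :: u, b :: v => if a < b then 1 else if a = b then ltVal u v else 0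

theorem eqVal_comm : ∀ u v : List (Fin k), eqVal u v = eqVal v u
  | [], [] => rfl
  | [], _ :: _ => rfl
  | _ :: _, [] => rfl
  | a :: u, b :: v => by simp [eqVal, eqVal_comm u v, eq_comm (a := a)]

theorem eqVal_self : ∀ u : List (Fin k), eqVal u u = 1
  | [] => rfl
  | a :: u => by simp [eqVal, eqVal_self u]

theorem ltVal_add_ltVal : ∀ u v : List (Fin k), ltVal u v + ltVal v u = 1 - eqVal u v
  | [], [] => by simp [ltVal, eqVal, letterSum]
  | [], _ :: _ => by simp [ltVal, eqVal, CharTwo.add_self_eq_zero]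
  | _ :: _, [] => by simp [ltVal, eqVal, CharTwo.add_self_eq_zero]
  | a :: u, b :: v => by
    rcases lt_trichotomy a b with h | rfl | h
    · simp [ltVal, eqVal, h, h.ne, h.ne', h.not_gt]
    · simpa [ltVal, eqVal] using ltVal_add_ltVal u v
    · simp [ltVal, eqVal, h, h.ne', h.not_gt]

theorem ltVal_append_singleton (a b : Fin k) :
    ∀ u : List (Fin k), ltVal (u ++ [a]) (u ++ [b]) = if a < b then 1 else 0
  | [] => by simp [ltVal, letterSum]
  | c :: u => by simpa [ltVal] using ltVal_append_singleton a b u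

theorem ltVal_self : ∀ u : List (Fin k), ltVal u u = 0
  | [] => by simp [ltVal, letterSum]
  | c :: u => by simpa [ltVal] using ltVal_self u

theorem exists_concat_eq (hk : 2 ≤ k) : ∀ u v : List (Fin k), eqVal u v ≠ 0 →
    ∃ x y : Cantor k, concat u x = concat v y
  | [], v, _ => ⟨concat v fun _ => ⟨0, by omega⟩, fun _ => ⟨0, by omega⟩, by
      funext i; simp [concat]⟩
  | a :: u, [], _ => ⟨fun _ => ⟨0, by omega⟩, concat (a :: u) fun _ => ⟨0, by omega⟩, by
      funext i; simp [concat]⟩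
  | a :: u, b :: v, h => by
    rw [eqVal] at h
    split_ifs at h with hab
    · subst hab
      obtain ⟨x, y, hxy⟩ := exists_concat_eq hk u v h
      refine ⟨x, y, ?_⟩
      rw [← List.singleton_append, concat_append, hxy, ← concat_append]
      rfl
    · exact absurd rfl h

section Odd

variable (hk : k % 4 = 1)

include hk

theorem natCast_eq_one : (k : ZMod 2) = 1 := by
  have : k = 2 * (k / 2) + 1 := by omega
  rw [this]
  push_cast
  have : (2 : ZMod 2) = 0 := rfl
  rw [this, zero_mul, zero_add]

theorem sum_letters : ∑ j : Fin k, (j.val : ZMod 2) = 0 := by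
  rw [Fin.sum_univ_eq_sum_range (fun j => (j : ZMod 2)), ← Nat.cast_sum, Finset.sum_range_id,
    ZMod.natCast_eq_zero_iff]
  obtain ⟨q, rfl⟩ : ∃ q, k = 4 * q + 1 := ⟨k / 4, by omega⟩
  refine ⟨(4 * q + 1) * q, ?_⟩
  rw [Nat.add_sub_cancel]
  exact Nat.div_eq_of_eq_mul_left (by norm_num) (by ring)

theorem sum_const_odd (x : ZMod 2) : ∑ _j : Fin k, x = x := by
  simp [natCast_eq_one hk]

theorem sum_eqVal : ∀ u v : List (Fin k), ∑ j, eqVal (u ++ [j]) v = eqVal u v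
  | [], [] => sum_const_odd hk _
  | [], b :: v => by simp [eqVal]
  | a :: u, [] => sum_const_odd hk _
  | a :: u, b :: v => by
    simp only [List.cons_append, eqVal]
    split_ifs
    · exact sum_eqVal u v
    · simp

theorem sum_ltVal : ∀ u v : List (Fin k), ∑ j, ltVal (u ++ [j]) v = ltVal u v
  | [], [] => by simp [ltVal, letterSum, sum_letters hk]
  | [], b :: v => by
    have h : ∀ j, ltVal ([] ++ [j]) (b :: v) =
        (if j < b then 1 else 0) + if j = b then letterSum v else 0 := by
      intro j
      simp only [List.nil_append, ltVal]
      rcases lt_trichotomy j b with h | rfl | h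
      · simp [h, h.ne]
      · simp
      · simp [h.ne', h.not_gt]
    simp only [h, Finset.sum_add_distrib, Finset.sum_boole, Finset.sum_ite_eq', Finset.mem_univ,
      if_true, ltVal, letterSum, List.map_cons, List.sum_cons]
    congr 2
    have : (Finset.univ.filter fun j => j < b) = Finset.Iio b := by ext; simp
    rw [this, Fin.card_Iio]
  | a :: u, [] => by
    have h : ∀ j, ltVal (a :: u ++ [j]) [] = letterSum (a :: u) + (j.val : ZMod 2) := by
      intro j
      simp [ltVal, letterSum, add_assoc]
    simp only [h, Finset.sum_add_distrib, sum_letters hk, sum_const_odd hk, add_zero]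
    rfl
  | a :: u, b :: v => by
    simp only [List.cons_append, ltVal]
    split_ifs
    · exact sum_const_odd hk _
    · exact sum_ltVal u v
    · simp

end Odd

end Invariants

section Sign

variable {n k r : ℕ}

/-- The factor in direction `l` of the `m`-th summand of `boxLt`. -/
def factor (m l : Fin n) (u v : List (Fin k)) : ZMod 2 :=
  if l < m then eqVal u v else if l = m then ltVal u v else 1

/-- An additive extension of a lexicographic order on disjoint boxes. -/
def boxLt (B C : Bx n k r) : ZMod 2 :=
  if B.2 < C.2 then 1 else if B.2 = C.2 then ∑ m, ∏ l, factor m l (B.1 l) (C.1 l) else 0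

theorem boxLt_spl (hk : k % 4 = 1) (i : Fin n) (B C : Bx n k r) :
    ∑ j, boxLt (spl i j B) C = boxLt B C := by
  have hf : ∀ (m l : Fin n) (u v : List (Fin k)),
      ∑ j, factor m l (u ++ [j]) v = factor m l u v := by
    intro m l u v
    unfold factor
    split_ifs
    · exact sum_eqVal hk u v
    · exact sum_ltVal hk u v
    · exact sum_const_odd hk _
  unfold boxLt
  change ∑ j, (if B.2 < C.2 then 1 else if B.2 = C.2 then _ else 0) = _
  split_ifs
  · exact sum_const_odd hk _
  · rw [Finset.sum_comm]
    refine Finset.sum_congr rfl fun m _ => ?_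
    have h1 : ∀ j, ∏ l, factor m l ((spl i j B).1 l) (C.1 l) =
        factor m i (B.1 i ++ [j]) (C.1 i) *
          ∏ l ∈ Finset.univ.erase i, factor m l (B.1 l) (C.1 l) := by
      intro j
      rw [← Finset.mul_prod_erase _ _ (Finset.mem_univ i)]
      congr 1
      · simp [spl]
      · refine Finset.prod_congr rfl fun l hl => ?_
        dsimp only [spl]
        rw [Function.update_of_ne (Finset.ne_of_mem_erase hl)]
    simp only [h1]
    rw [← Finset.sum_mul, hf, Finset.mul_prod_erase _ (fun l => factor m l (B.1 l) (C.1 l))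
      (Finset.mem_univ i)]
  · simp

theorem prod_factor (m : Fin n) (u v : Fin n → List (Fin k)) :
    ∏ l, factor m l (u l) (v l) =
      ltVal (u m) (v m) * ∏ l ∈ Finset.univ with l < m, eqVal (u l) (v l) := by
  have : ∀ l, factor m l (u l) (v l) =
      (if l = m then ltVal (u l) (v l) else 1) * if l < m then eqVal (u l) (v l) else 1 := by
    intro l
    unfold factor
    rcases lt_trichotomy l m with h | rfl | h
    · simp [h, h.ne]
    · simp
    · simp [h.ne', h.not_gt]
  simp only [this, Finset.prod_mul_distrib, Finset.prod_filter]
  simp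

theorem boxLt_add_boxLt (hk : 2 ≤ k) {B C : Bx n k r}
    (h : ∀ y, y ∈ box B.1 B.2 → y ∉ box C.1 C.2) : boxLt B C + boxLt C B = 1 := by
  unfold boxLt
  rcases lt_trichotomy B.2 C.2 with ha | ha | ha
  · simp [ha, ha.ne', ha.not_gt]
  · simp only [ha, lt_self_iff_false, if_false, if_true, prod_factor]
    have h0 : ∏ l, eqVal (B.1 l) (C.1 l) = 0 := by
      by_contra hne
      rw [← ne_eq, Finset.prod_ne_zero_iff] at hne
      choose x y hxy using fun l => exists_concat_eq hk _ _ (hne l (Finset.mem_univ l))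
      exact h (fun l => concat (B.1 l) (x l), B.2) ⟨x, rfl⟩ ⟨y, Prod.ext (funext hxy) ha⟩
    have h1 : ∀ l, 1 - (ltVal (B.1 l) (C.1 l) + ltVal (C.1 l) (B.1 l)) =
        eqVal (B.1 l) (C.1 l) := by
      intro l
      rw [ltVal_add_ltVal, sub_sub_cancel]
    have h2 := Finset.prod_one_sub_ordered Finset.univ
      fun l => ltVal (B.1 l) (C.1 l) + ltVal (C.1 l) (B.1 l)
    simp only [h1, h0, add_mul, Finset.sum_add_distrib] at h2
    simp only [eqVal_comm (C.1 _) (B.1 _)]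
    exact (sub_eq_zero.1 h2.symm).symm
  · simp [ha, ha.ne', ha.not_gt]

theorem boxLt_spl_spl (i : Fin n) (a b : Fin k) (B : Bx n k r) :
    boxLt (spl i a B) (spl i b B) = if a < b then 1 else 0 := by
  unfold boxLt
  simp only [spl, lt_self_iff_false, if_false, if_true, prod_factor]
  rw [Finset.sum_eq_single i]
  · rw [Function.update_self, Function.update_self, ltVal_append_singleton,
      Finset.prod_eq_one, mul_one]
    intro l hl
    have : l ≠ i := (Finset.mem_filter.1 hl).2.ne
    rw [Function.update_of_ne this, Function.update_of_ne this, eqVal_self]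
  · intro m _ hm
    rw [Function.update_of_ne hm, Function.update_of_ne hm, ltVal_self, zero_mul]
  · simp

/-- The contribution of a pair of entries of a table to the sign. -/
def pairVal (p q : Bx n k r × Bx n k r) : ZMod 2 := boxLt p.1 q.1 + boxLt p.2 q.2

/-- The sum of `pairVal` over the pairs of entries of a list. -/
def pairSum : List (Bx n k r × Bx n k r) → ZMod 2
  | [] => 0
  | p :: L => (L.map (pairVal p)).sum + pairSum L

/-- The sign of a table. -/
noncomputable def sgn (M : Multiset (Bx n k r × Bx n k r)) : ZMod 2 := pairSum M.toList

theorem pairSum_perm {L L' : List (Bx n k r × Bx n k r)} (h : L.Perm L')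
    (hL : L.Pairwise fun p q => pairVal p q = pairVal q p) : pairSum L = pairSum L' := by
  induction h with
  | nil => rfl
  | cons a h ih =>
    rw [pairSum, pairSum, ih (List.pairwise_cons.1 hL).2, (h.map _).sum_eq]
  | swap a b l =>
    have := (List.pairwise_cons.1 hL).1 a (by simp)
    simp only [pairSum, List.map_cons, List.sum_cons, this]
    ring
  | trans h h' ih ih' =>
    exact (ih hL).trans (ih' (h.pairwise hL fun {_ _} e => e.symm))

theorem pairSum_append (L L' : List (Bx n k r × Bx n k r)) :
    pairSum (L ++ L') = pairSum L + (L'.map fun q => (L.map fun p => pairVal p q).sum).sum +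
      pairSum L' := by
  induction L with
  | nil => simp [pairSum]
  | cons p L ih =>
    simp only [List.cons_append, pairSum, ih, List.map_append, List.sum_append, List.map_cons,
      List.sum_cons, List.sum_map_add]
    ring

theorem IsTab.pairwise (hk : 2 ≤ k) {L : List (Bx n k r × Bx n k r)}
    (h : IsTab (L : Multiset (Bx n k r × Bx n k r))) :
    L.Pairwise fun p q => pairVal p q = pairVal q p := by
  rw [List.pairwise_iff_forall_sublist]
  intro p q hpq
  obtain ⟨R, hR⟩ := Multiset.le_iff_exists_add.1 (Multiset.coe_le.2 hpq.subperm)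
  have hpq' : (([p, q] : List _) : Multiset (Bx n k r × Bx n k r)) = p ::ₘ q ::ₘ 0 := rfl
  rw [hR, hpq'] at h
  have h1 := boxLt_add_boxLt hk (IsPart.disjoint (R := R.map Prod.fst) (by simpa using h.1))
  have h2 := boxLt_add_boxLt hk (IsPart.disjoint (R := R.map Prod.snd) (by simpa using h.2))
  rw [← CharTwo.add_eq_zero]
  calc _ = (boxLt p.1 q.1 + boxLt q.1 p.1) + (boxLt p.2 q.2 + boxLt q.2 p.2) := by
        simp only [pairVal]; ring
    _ = 0 := by rw [h1, h2]; rfl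

theorem sgn_coe (hk : 2 ≤ k) {L : List (Bx n k r × Bx n k r)}
    (h : IsTab (L : Multiset (Bx n k r × Bx n k r))) :
    sgn (L : Multiset (Bx n k r × Bx n k r)) = pairSum L :=
  (pairSum_perm (coe_eq_coe.1 (coe_toList _)).symm (h.pairwise hk)).symm

theorem sgn_spl (hk : k % 4 = 1) (hk' : 2 ≤ k) (i i' : Fin n) {B C : Bx n k r}
    {R : Multiset (Bx n k r × Bx n k r)} (h : IsTab ((B, C) ::ₘ R)) :
    sgn ((Finset.univ : Finset (Fin k)).val.map (fun j => (spl i j B, spl i' j C)) + R) =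
      sgn ((B, C) ::ₘ R) := by
  induction R using Quotient.inductionOn with
  | h L =>
    let P : List (Bx n k r × Bx n k r) :=
      (List.finRange k).map fun j => (spl i j B, spl i' j C)
    have hP : (Finset.univ : Finset (Fin k)).val.map (fun j => (spl i j B, spl i' j C)) + ↑L =
      ((P ++ L : List _) : Multiset (Bx n k r × Bx n k r)) := rfl
    have ht : IsTab ((P ++ L : List _) : Multiset (Bx n k r × Bx n k r)) := by
      rw [← hP]
      constructor
      · have : IsPart (B ::ₘ (L : Multiset (Bx n k r × Bx n k r)).map Prod.fst) := by
          simpa using h.1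
        simpa only [Multiset.map_add, Multiset.map_map, Function.comp_def, pieces] using
          this.pieces_add i
      · have : IsPart (C ::ₘ (L : Multiset (Bx n k r × Bx n k r)).map Prod.snd) := by
          simpa using h.2
        simpa only [Multiset.map_add, Multiset.map_map, Function.comp_def, pieces] using
          this.pieces_add i'
    have h0 : ∀ l : List (Fin k), pairSum (l.map fun j => (spl i j B, spl i' j C)) = 0 := by
      intro l
      induction l with
      | nil => rfl
      | cons a l ih =>
        simp [pairSum, ih, pairVal, boxLt_spl_spl, CharTwo.add_self_eq_zero, Function.comp_def]
    have h1 : ∀ q, (P.map fun p => pairVal p q).sum = pairVal (B, C) q := by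
      intro q
      simp only [P, List.map_map, Function.comp_def, pairVal, List.sum_map_add]
      rw [← boxLt_spl hk i B, ← boxLt_spl hk i' C, Fin.sum_univ_def, Fin.sum_univ_def]
    rw [quot_mk_to_coe] at h ⊢
    rw [hP, cons_coe, sgn_coe hk' ht, sgn_coe hk' h, pairSum_append, h0, zero_add, pairSum]
    simp only [h1]

theorem inv_sgn (hk : k % 4 = 1) (hk' : 2 ≤ k) :
    Inv (sgn : Multiset (Bx n k r × Bx n k r) → ZMod 2) where
  split := by
    rintro ⟨B, C⟩ R i h
    exact sgn_spl hk hk' i i h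
  comp := by
    intro T h1 h2 h3
    induction T using Quotient.inductionOn with
    | h L =>
      simp only [quot_mk_to_coe, map_coe] at h1 h2 h3 ⊢
      rw [sgn_coe hk'
          ⟨by simpa [Function.comp_def] using h1, by simpa [Function.comp_def] using h3⟩,
        sgn_coe hk' ⟨by simpa [Function.comp_def] using h1, by simpa [Function.comp_def] using h2⟩,
        sgn_coe hk' ⟨by simpa [Function.comp_def] using h2, by simpa [Function.comp_def] using h3⟩]
      clear h1 h2 h3
      induction L with
      | nil => simp [pairSum]
      | cons t L ih =>
        simp only [List.map_cons, pairSum, ih, List.map_map, Function.comp_def, pairVal,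
          List.sum_map_add]
        have := CharTwo.add_self_eq_zero (L.map fun x => boxLt t.2.1 x.2.1).sum
        linear_combination -this

theorem pairVal_diag (B C : Bx n k r) : pairVal (B, B) (C, C) = 0 := CharTwo.add_self_eq_zero _

theorem sgn_swapTab (hk : 2 ≤ k) {B C : Bx n k r} {R : Multiset (Bx n k r)}
    (h : IsPart ({B, C} + R)) : sgn (swapTab B C R) = 1 := by
  have ht := h.swapTab
  have hBC := boxLt_add_boxLt hk (IsPart.disjoint (R := R) (by simpa using h))
  induction R using Quotient.inductionOn with
  | h L =>
    have e : swapTab B C ⟦L⟧ = (([(B, C), (C, B)] ++ L.map fun D => (D, D) : List _) :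
      Multiset (Bx n k r × Bx n k r)) := rfl
    rw [e] at ht ⊢
    have h0 : ∀ l : List (Bx n k r), pairSum (l.map fun D => (D, D)) = 0 := by
      intro l
      induction l with
      | nil => rfl
      | cons a l ih => simp [pairSum, ih, pairVal_diag, Function.comp_def]
    rw [sgn_coe hk ht, pairSum_append, h0]
    have h1 : ∀ D : Bx n k r, ([(B, C), (C, B)].map fun p => pairVal p (D, D)).sum = 0 := by
      intro D
      simp only [pairVal, List.map_cons, List.map_nil, List.sum_cons, List.sum_nil, add_zero]
      rw [add_comm (boxLt C D)]
      exact CharTwo.add_self_eq_zero _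
    simp only [List.map_map, Function.comp_def, h1]
    simpa [pairSum, pairVal] using hBC

theorem sgn_turn (hk : k % 4 = 1) (hk' : 2 ≤ k) (i i' : Fin n) {B : Bx n k r}
    {R : Multiset (Bx n k r)} (h : IsPart (B ::ₘ R)) : sgn (turn i i' B + diag R) = 0 := by
  rw [← (inv_sgn hk hk').diag h, diag_cons]
  exact sgn_spl hk hk' i i' (by rw [← diag_cons]; exact isTab_diag h)

end Sign

section Assembly

variable {n k r : ℕ}

theorem isPart_trivial : IsPart ((Finset.univ : Finset (Fin r)).val.map
    fun a => ((fun _ => [], a) : Bx n k r)) := by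
  rw [isPart_map_iff]
  intro y
  refine ⟨y.2, (mem_box_iff _ y).2 ⟨rfl, fun _ => rfl⟩, fun a ha => ?_⟩
  exact ((mem_box_iff _ y).1 ha).1.symm

theorem exists_isPart (hk : 2 ≤ k) (hr : 1 ≤ r) (i : Fin n) :
    ∃ (B C : Bx n k r) (R : Multiset (Bx n k r)), IsPart ({B, C} + R) ∧ R ≠ 0 := by
  have h0 : (Finset.univ : Finset (Fin r)).val.map
      (fun a => ((fun _ => [], a) : Bx n k r)) ≠ 0 := by
    rw [← card_pos, card_map, Finset.card_val, Finset.card_univ, Fintype.card_fin]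
    exact hr
  obtain ⟨P, hP, hc⟩ := exists_refines_card hk i h0 2
  have hc3 : 3 ≤ card P := by
    rw [card_map, Finset.card_val, Finset.card_univ, Fintype.card_fin] at hc
    omega
  obtain ⟨B, hB⟩ := card_pos_iff_exists_mem.1 (by omega : 0 < card P)
  obtain ⟨P', rfl⟩ := exists_cons_of_mem hB
  rw [card_cons] at hc3
  obtain ⟨C, hC⟩ := card_pos_iff_exists_mem.1 (by omega : 0 < card P')
  obtain ⟨R, rfl⟩ := exists_cons_of_mem hC
  rw [card_cons] at hc3
  refine ⟨B, C, R, ?_, ?_⟩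
  · simpa using isPart_trivial.refines hP
  · rw [← card_pos]
    omega

/-- Computation of the abelianization from a complete additive invariant. -/
theorem nonempty_mulEquiv (hk : 2 ≤ k) {T : Type*} [AddCommGroup T]
    {w : Multiset (Bx n k r × Bx n k r) → T} (hw : Inv w) {P₀ : Multiset (Bx n k r)}
    (hP₀ : IsPart P₀) (hc : 3 ≤ card P₀)
    (H : ∀ {A : Type} [AddCommGroup A] (val : Multiset (Bx n k r × Bx n k r) → A), Inv val →
      ∃ Ψ : T →+ A, (∀ B C R, IsPart ({B, C} + R) → R ≠ 0 → val (swapTab B C R) ∈ Ψ.range) ∧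
        (∀ i i' B R, IsPart (B ::ₘ R) → R ≠ 0 → val (turn i i' B + diag R) ∈ Ψ.range) ∧
        ∀ Θ : A →+ T, (∀ M, IsTab M → Θ (val M) = w M) → Θ.comp Ψ = AddMonoidHom.id T)
    (G : Subgroup (Equiv.Perm (Y n k r)))
    (hG : (G : Set (Equiv.Perm (Y n k r))) = thompsonSet n k r) :
    Nonempty (Abelianization G ≃* Multiplicative T) := by
  obtain ⟨Φ, hΦ⟩ := hw.exists_hom hk G hG
  obtain ⟨val, hv, hval⟩ := exists_inv (A := Additive (Abelianization G)) G hG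
    (MonoidHom.mk' (fun γ => .ofAdd (.ofMul (Abelianization.of γ))) fun γ γ' => by
      rw [map_mul]; rfl)
  obtain ⟨Ψ, h1, h2, h3⟩ := H val hv
  let Θ : Additive (Abelianization G) →+ T := AddMonoidHom.mk'
    (fun x => (Abelianization.lift Φ x.toMul).toAdd) fun x y => by
      rw [toMul_add, map_mul]; rfl
  have hΘ : ∀ t, Θ (Ψ t) = t := by
    refine fun t => DFunLike.congr_fun (h3 Θ fun M hM => ?_) t
    obtain ⟨γ, hγ⟩ := hM.exists_isTable
    have hmem : γ ∈ G := by
      rw [← SetLike.mem_coe, hG]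
      exact (isElement_iff γ).2 ⟨M, hγ⟩
    rw [hval ⟨γ, hmem⟩ M hγ]
    change (Abelianization.lift Φ (Abelianization.of _)).toAdd = _
    rw [Abelianization.lift_apply_of, hΦ _ M hγ]
    rfl
  have hΨ : Function.Surjective Ψ := by
    intro a
    obtain ⟨γ, hγ⟩ : ∃ γ, Abelianization.of γ = a.toMul := QuotientGroup.mk_surjective a.toMul
    have hmem := γ.2
    rw [← SetLike.mem_coe, hG] at hmem
    obtain ⟨M, hM⟩ := (isElement_iff γ.1).1 hmem
    have := hv.mem hk h1 h2 hP₀ hc hM.1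
    rw [hval γ M hM] at this
    change Additive.ofMul (Abelianization.of γ) ∈ _ at this
    rwa [hγ] at this
  refine ⟨MulEquiv.ofBijective (Abelianization.lift Φ) ⟨fun x y hxy => ?_, fun t => ?_⟩⟩
  · obtain ⟨s, hs⟩ := hΨ (.ofMul x)
    obtain ⟨t, ht⟩ := hΨ (.ofMul y)
    have : Θ (.ofMul x) = Θ (.ofMul y) := congrArg Multiplicative.toAdd hxy
    rw [← hs, ← ht, hΘ, hΘ] at this
    exact Additive.ofMul.injective (hs.symm.trans ((congrArg Ψ this).trans ht))
  · exact ⟨(Ψ t.toAdd).toMul, congrArg Multiplicative.ofAdd (hΘ t.toAdd)⟩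

section Hom

variable {A : Type*} [AddCommGroup A]

theorem exists_zmod_hom {d : ℕ} {x : A} (hx : d • x = 0) : ∃ ψ : ZMod d →+ A, ψ 1 = x := by
  refine ⟨ZMod.lift d ⟨zmultiplesHom A x, by simpa using hx⟩, ?_⟩
  have := ZMod.lift_coe d ⟨zmultiplesHom A x, by simpa using hx⟩ 1
  simpa using this

theorem zmod_hom_ext {d : ℕ} {f g : ZMod d →+ A} (h : f 1 = g 1) : f = g := by
  ext x
  obtain ⟨z, rfl⟩ := ZMod.intCast_surjective x
  rw [← zsmul_one, map_zsmul, map_zsmul, h]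

theorem exists_pi_hom {m d : ℕ} {x : Fin m → A} (hx : ∀ i, d • x i = 0) :
    ∃ ψ : (Fin m → ZMod d) →+ A, ∀ i, ψ (Pi.single i 1) = x i := by
  choose ψ hψ using fun i => exists_zmod_hom (hx i)
  refine ⟨∑ i, (ψ i).comp (Pi.evalAddMonoidHom _ i), fun i => ?_⟩
  rw [AddMonoidHom.finsetSum_apply, Finset.sum_eq_single i]
  · simpa using hψ i
  · intro j _ hj
    simp [hj]
  · simp

theorem pi_hom_ext {m d : ℕ} {f g : (Fin m → ZMod d) →+ A}
    (h : ∀ i, f (Pi.single i 1) = g (Pi.single i 1)) : f = g :=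
  AddMonoidHom.functions_ext' _ _ _ fun i => zmod_hom_ext (h i)

end Hom

section Relations

variable {A : Type*} [AddCommGroup A] {val : Multiset (Bx n k r × Bx n k r) → A} {ε : A}
  {b : Fin n → Fin n → A}

theorem Inv.swap_eq_zero (hn : 3 ≤ n) (hk : 2 ≤ k) (hv : Inv val)
    (hε : ∀ B C R, IsPart ({B, C} + R) → R ≠ 0 → val (swapTab B C R) = ε)
    (hb : ∀ i i' B R, IsPart (B ::ₘ R) → R ≠ 0 → val (turn i i' B + NV.diag R) = b i i')
    {B C : Bx n k r} {R : Multiset (Bx n k r)} (h : IsPart ({B, C} + R)) (hR : R ≠ 0)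
    (hk' : Even k ∨ k % 4 = 3) : ε = 0 := by
  have h2 := hv.two_nsmul_swap hε h hR
  have even_nsmul : ∀ q, (2 * q) • ε = 0 := fun q => by rw [mul_comm, mul_nsmul', h2, nsmul_zero]
  rcases hk' with ⟨q, hq⟩ | hk'
  · rw [← hv.card_nsmul_swap hε ⟨0, by omega⟩ h hR, hq, ← two_mul, even_nsmul]
  · have hodd : ∀ i i', i ≠ i' → (k - 1) • b i i' = ε := by
      intro i i' hi
      obtain ⟨c, hc, e⟩ := hv.nsmul_turn hk hε hb hi h hR
      obtain ⟨q, rfl⟩ : ∃ q, k = 4 * q + 3 := ⟨k / 4, by omega⟩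
      have : c = 2 * (4 * q * q + 5 * q + 1) + 1 := by linarith
      rw [e, this, succ_nsmul, even_nsmul, zero_add]
    have h' : IsPart (B ::ₘ (C ::ₘ R)) := by simpa using h
    have e := hv.turn_add hb h' (by simp) ⟨0, by omega⟩ ⟨1, by omega⟩ ⟨2, by omega⟩
    have e' := congrArg ((k - 1) • ·) e
    simp only [nsmul_add] at e'
    rw [hodd _ _ (by simp), hodd _ _ (by simp), hodd _ _ (by simp)] at e'
    exact (left_eq_add.1 e')

theorem Inv.nsmul_turn_eq_zero (hn : 3 ≤ n) (hk : 2 ≤ k) (hv : Inv val)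
    (hε : ∀ B C R, IsPart ({B, C} + R) → R ≠ 0 → val (swapTab B C R) = ε)
    (hb : ∀ i i' B R, IsPart (B ::ₘ R) → R ≠ 0 → val (turn i i' B + NV.diag R) = b i i')
    {B C : Bx n k r} {R : Multiset (Bx n k r)} (h : IsPart ({B, C} + R)) (hR : R ≠ 0)
    {i i' : Fin n} (hi : i ≠ i') : (k - 1) • b i i' = 0 := by
  obtain ⟨c, hc, e⟩ := hv.nsmul_turn hk hε hb hi h hR
  rw [e]
  by_cases hk' : Even k ∨ k % 4 = 3
  · rw [hv.swap_eq_zero hn hk hε hb h hR hk', nsmul_zero]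
  · obtain ⟨q, rfl⟩ : ∃ q, k = 4 * q + 1 := by
      rw [not_or, Nat.even_iff] at hk'
      exact ⟨k / 4, by omega⟩
    have : c = (q * (4 * q + 1)) * 2 := by linarith
    rw [this, mul_nsmul', hv.two_nsmul_swap hε h hR, nsmul_zero]

end Relations

theorem turn_mem {m : ℕ} {A : Type*} [AddCommGroup A]
    {val : Multiset (Bx (m + 1) k r × Bx (m + 1) k r) → A} (hv : Inv val)
    {b : Fin (m + 1) → Fin (m + 1) → A}
    (hb : ∀ i i' B R, IsPart (B ::ₘ R) → R ≠ 0 → val (turn i i' B + NV.diag R) = b i i')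
    {S : AddSubgroup A} (hS : ∀ l : Fin m, b (Fin.last m) l.castSucc ∈ S)
    {B : Bx (m + 1) k r} {R : Multiset (Bx (m + 1) k r)} (h : IsPart (B ::ₘ R)) (hR : R ≠ 0)
    (i i' : Fin (m + 1)) : b i i' ∈ S := by
  have key : ∀ i, b (Fin.last m) i ∈ S := by
    intro i
    induction i using Fin.lastCases with
    | last =>
      have := hv.turn_add hb h hR (Fin.last m) (Fin.last m) (Fin.last m)
      rw [left_eq_add.1 this]
      exact S.zero_mem
    | cast l => exact hS l
  have := hv.turn_add hb h hR (Fin.last m) i i'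
  rw [← sub_eq_iff_eq_add'.2 this]
  exact S.sub_mem (key i') (key i)

/-- The length invariants of a table. -/
def lenVec {m : ℕ} (M : Multiset (Bx (m + 1) k r × Bx (m + 1) k r)) : Fin m → ZMod (k - 1) :=
  fun l => lenVal l.castSucc M

theorem inv_lenVec {m : ℕ} (hk : 2 ≤ k) :
    Inv (lenVec : Multiset (Bx (m + 1) k r × Bx (m + 1) k r) → Fin m → ZMod (k - 1)) where
  split i h := funext fun l => (inv_lenVal hk l.castSucc).split i h
  comp T h₁ h₂ h₃ := funext fun l => (inv_lenVal hk l.castSucc).comp T h₁ h₂ h₃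

theorem lenVec_turn {m : ℕ} (hk : 2 ≤ k) (l : Fin m) (B : Bx (m + 1) k r)
    (R : Multiset (Bx (m + 1) k r)) :
    lenVec (turn (Fin.last m) l.castSucc B + diag R) = Pi.single l 1 := by
  funext l'
  rw [lenVec, lenVal_add, lenVal_diag, turn, lenVal_turn hk, Pi.single_apply]
  simp [Fin.ext_iff, l'.2.ne]

theorem lenVec_swapTab {m : ℕ} (B C : Bx (m + 1) k r) (R : Multiset (Bx (m + 1) k r)) :
    lenVec (swapTab B C R) = 0 :=
  funext fun l => lenVal_swapTab l.castSucc B C R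

theorem inv_prod {T T' : Type*} [AddCommGroup T] [AddCommGroup T']
    {w : Multiset (Bx n k r × Bx n k r) → T} {w' : Multiset (Bx n k r × Bx n k r) → T'}
    (hw : Inv w) (hw' : Inv w') : Inv fun M => (w M, w' M) where
  split i h := Prod.ext (hw.split i h) (hw'.split i h)
  comp T h₁ h₂ h₃ := Prod.ext (hw.comp T h₁ h₂ h₃) (hw'.comp T h₁ h₂ h₃)

theorem nonempty_mulEquiv_pi {m : ℕ} (hm : 2 ≤ m) (hk : 2 ≤ k) (hr : 1 ≤ r)
    (hk' : Even k ∨ k % 4 = 3) (G : Subgroup (Equiv.Perm (Y (m + 1) k r)))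
    (hG : (G : Set (Equiv.Perm (Y (m + 1) k r))) = thompsonSet (m + 1) k r) :
    Nonempty (Abelianization G ≃* Multiplicative (Fin m → ZMod (k - 1))) := by
  obtain ⟨B, C, R, h, hR⟩ := exists_isPart (n := m + 1) hk hr 0
  have h' : IsPart (B ::ₘ (C ::ₘ R)) := by simpa using h
  refine nonempty_mulEquiv hk (inv_lenVec hk) h ?_ (fun val hv => ?_) G hG
  · have := card_pos.2 hR
    simp
    omega
  obtain ⟨ε, hε⟩ := hv.exists_swap hk 0
  choose b hb using fun i i' => hv.exists_turn hk i i'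
  have hd := fun l : Fin m => hv.nsmul_turn_eq_zero (by omega) hk hε hb h hR
    (Fin.castSucc_lt_last l).ne'
  obtain ⟨Ψ, hΨ⟩ := exists_pi_hom hd
  refine ⟨Ψ, fun B C R h hR => ?_, fun i i' B R h hR => ?_, fun Θ hΘ => pi_hom_ext fun l => ?_⟩
  · rw [hε B C R h hR, hv.swap_eq_zero (by omega) hk hε hb h hR hk']
    exact Ψ.range.zero_mem
  · rw [hb i i' B R h hR]
    exact turn_mem (S := Ψ.range) hv hb (fun l => ⟨_, hΨ l⟩) h hR i i'
  · rw [AddMonoidHom.comp_apply, hΨ, ← hb _ _ B _ h' (by simp), hΘ _ (h'.turn _ _),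
      lenVec_turn hk]
    rfl

theorem nonempty_mulEquiv_prod {m : ℕ} (hm : 2 ≤ m) (hk : 2 ≤ k) (hr : 1 ≤ r)
    (hk' : k % 4 = 1) (G : Subgroup (Equiv.Perm (Y (m + 1) k r)))
    (hG : (G : Set (Equiv.Perm (Y (m + 1) k r))) = thompsonSet (m + 1) k r) :
    Nonempty (Abelianization G ≃* Multiplicative ((Fin m → ZMod (k - 1)) × ZMod 2)) := by
  obtain ⟨B, C, R, h, hR⟩ := exists_isPart (n := m + 1) hk hr 0
  have h' : IsPart (B ::ₘ (C ::ₘ R)) := by simpa using h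
  refine nonempty_mulEquiv hk (inv_prod (inv_lenVec hk) (inv_sgn hk' hk)) h ?_
    (fun val hv => ?_) G hG
  · have := card_pos.2 hR
    simp
    omega
  obtain ⟨ε, hε⟩ := hv.exists_swap hk 0
  choose b hb using fun i i' => hv.exists_turn hk i i'
  have hd := fun l : Fin m => hv.nsmul_turn_eq_zero (by omega) hk hε hb h hR
    (Fin.castSucc_lt_last l).ne'
  obtain ⟨Ψ, hΨ⟩ := exists_pi_hom hd
  obtain ⟨ψ, hψ⟩ := exists_zmod_hom (hv.two_nsmul_swap hε h hR)
  refine ⟨Ψ.coprod ψ, fun B C R h hR => ?_, fun i i' B R h hR => ?_, fun Θ hΘ => ?_⟩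
  · exact ⟨(0, 1), by simp [hψ, hε B C R h hR]⟩
  · rw [hb i i' B R h hR]
    exact turn_mem (S := (Ψ.coprod ψ).range) hv hb
      (fun l => ⟨(Pi.single l 1, 0), by simp [hΨ]⟩) h hR i i'
  · rw [← AddMonoidHom.coprod_inl_inr]
    have e1 : Θ.comp Ψ = AddMonoidHom.inl _ _ := pi_hom_ext fun l => by
      rw [AddMonoidHom.comp_apply, hΨ, ← hb _ _ B _ h' (by simp), hΘ _ (h'.turn _ _),
        lenVec_turn hk, sgn_turn hk' hk _ _ h']
      rfl
    have e2 : Θ.comp ψ = AddMonoidHom.inr _ _ := zmod_hom_ext <| by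
      rw [AddMonoidHom.comp_apply, hψ, ← hε B C R h hR, hΘ _ h.swapTab, lenVec_swapTab,
        sgn_swapTab hk h]
      rfl
    rw [← e1, ← e2, AddMonoidHom.comp_coprod]

end Assembly

end NV

theorem statement3 (n k r : ℕ) (hn : 3 ≤ n) (hk : 2 ≤ k) (hr : 1 ≤ r)
    (G : Subgroup (Equiv.Perm (NV.Y n k r)))
    (hG : (G : Set (Equiv.Perm (NV.Y n k r))) = NV.thompsonSet n k r) :
    ((Even k ∨ k % 4 = 3) →
      Nonempty (Abelianization ↥G ≃* Multiplicative (Fin (n - 1) → ZMod (k - 1)))) ∧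
    (k % 4 = 1 →
      Nonempty (Abelianization ↥G ≃*
        Multiplicative ((Fin (n - 1) → ZMod (k - 1)) × ZMod 2))) := by
  obtain ⟨m, rfl⟩ := Nat.exists_eq_add_of_le' (by omega : 1 ≤ n)
  exact ⟨fun hk' => NV.nonempty_mulEquiv_pi (by omega) hk hr hk' G hG,
    fun hk' => NV.nonempty_mulEquiv_prod (by omega) hk hr hk' G hG⟩
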